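/- arXiv:2310.05788 — 3 statements merged into one kernel-verified Lean document; each statement's English description precedes it below -/
import Mathlib

section
/- For every ε > 0 there exists N such that for all n ≥ N the following holds. Let R be any family of subsets of Z_n \ {0} that is isomorphism-invariant, i.e., if S ∈ R and Cay(Z_n,T) is isomorphic to Cay(Z_n,S) as a digraph, then T ∈ R. Let L be the number of digraphs on the vertex set {0,1,…,n−1} that are isomorphic to Cay(Z_n,T) for some T ⊆ Z_n \ {0} (the labeled circulant digraphs), and let L(R) be the number of those isomorphic to Cay(Z_n,T) for some T ∈ R. Let u(R) be the number of isomorphism classes of {Cay(Z_n,S) : S ∈ R} and u(C) the number of isomorphism classes of all Cayley digraphs of Z_n. Then L(R)/L ≥ u(R)/u(C) − 2^{(−1/4+ε)·n}. -/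
/-- The Cayley digraphs `Cay(Z_n,S)` and `Cay(Z_n,T)` are isomorphic. -/
def CayIso (n : ℕ) (S T : Finset (ZMod n)) : Prop :=
  ∃ φ : ZMod n ≃ ZMod n, ∀ x y : ZMod n, y - x ∈ S ↔ φ y - φ x ∈ T

/-- The number of isomorphism classes of the digraphs `{Cay(Z_n,S) : S ∈ R}`. -/
noncomputable def numIsoClasses (n : ℕ) (R : Set (Finset (ZMod n))) : ℕ :=
  ((fun S => {T : Finset (ZMod n) | CayIso n S T}) '' R).ncard

/-- The digraph on the vertex set `{0,…,n-1}` with arc set `E` is isomorphic to the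
Cayley digraph `Cay(Z_n,T)`. -/
def IsLabeledCopy (n : ℕ) (E : Set (Fin n × Fin n)) (T : Finset (ZMod n)) : Prop :=
  ∃ φ : Fin n ≃ ZMod n, ∀ x y : Fin n, (x, y) ∈ E ↔ φ y - φ x ∈ T

theorem normalizer_eq_self_of_isCoatom {G : Type*} [Group G] {A : Subgroup G}
    (hmax : IsCoatom A) (hA : ¬ A.Normal) : Subgroup.normalizer (A : Set G) = A := by
  rcases hmax.le_iff.1 (Subgroup.le_normalizer (H := A)) with h | h
  · exact absurd (Subgroup.normalizer_eq_top_iff.1 h) hA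
  · exact h

/-- Two distinct conjugates of a commutative maximal subgroup meet in the center. -/
theorem mem_center_of_conj_mem {G : Type*} [Group G] [Finite G] {A : Subgroup G}
    (hcomm : ∀ x ∈ A, ∀ y ∈ A, x * y = y * x) (hmax : IsCoatom A) (hA : ¬ A.Normal)
    {g x : G} (hg : g ∉ A) (hx : g⁻¹ * x * g ∈ A) (hx' : x ∈ A) : x ∈ Subgroup.center G := by
  have hle : A ≤ Subgroup.centralizer {x} := fun y hy =>
    Subgroup.mem_centralizer_singleton_iff.2 (hcomm _ hy _ hx')
  rcases hmax.le_iff.1 hle with h | h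
  · rw [Subgroup.mem_center_iff]
    intro y
    have : y ∈ Subgroup.centralizer {x} := h ▸ Subgroup.mem_top y
    exact Subgroup.mem_centralizer_singleton_iff.1 this
  · exfalso
    apply hg
    rw [← normalizer_eq_self_of_isCoatom hmax hA]
    have key : A.map (MulAut.conj g).toMonoidHom ≤ A := by
      rw [Subgroup.map_le_iff_le_comap]
      intro y hy
      rw [Subgroup.mem_comap, ← h, Subgroup.mem_centralizer_singleton_iff]
      have := hcomm _ hy _ hx
      simp only [MulEquiv.coe_toMonoidHom, MulAut.conj_apply]
      calc g * y * g⁻¹ * x = g * (y * (g⁻¹ * x * g)) * g⁻¹ := by group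
        _ = x * (g * y * g⁻¹) := by rw [this]; group
    have key2 : A.map (MulAut.conj g).toMonoidHom = A := by
      apply Subgroup.eq_of_le_of_card_ge key
      rw [Subgroup.card_map_of_injective (MulAut.conj g).injective]
    rw [Subgroup.mem_normalizer_iff]
    intro y
    conv_rhs => rw [← key2]
    rw [Subgroup.mem_map]
    simp

open MulAction in
open scoped IsMulCommutative Pointwise in
/-- If a commutative maximal subgroup `A` of a finite group is not normal and has a complement
`H`, then `H * center G` is normal. -/
theorem exists_conj_eq_mul_center {G : Type*} [Group G] [Finite G] {A H : Subgroup G}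
    (hcomm : ∀ x ∈ A, ∀ y ∈ A, x * y = y * x) (hmax : IsCoatom A) (hA : ¬ A.Normal)
    (hH : H.IsComplement' A) {a h : G} (hh : h ∈ H) :
    ∃ h' ∈ H, ∃ z ∈ A, z ∈ Subgroup.center G ∧ a⁻¹ * h * a = h' * z := by
  classical
  have : IsMulCommutative A := ⟨⟨fun x y => Subtype.ext (hcomm x x.2 y y.2)⟩⟩
  let Z : Subgroup A := (Subgroup.center G).subgroupOf A
  let ϕ : A →* A ⧸ Z := QuotientGroup.mk' Z
  let V := MonoidHom.transfer ϕ
  have hVH : ∀ x ∈ H, V x = 1 := by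
    intro x hx
    let T : A.LeftTransversal := ⟨(H : Set G), hH⟩
    have hT : x • T = T := by
      apply Subtype.ext
      change x • (H : Set G) = H
      exact smul_coe_set hx
    change MonoidHom.transfer ϕ x = 1
    rw [MonoidHom.transfer_def ϕ T, hT, Subgroup.leftTransversals.diff_self]
  have hϕ : ∀ (x : G) (hx : x ∈ A), x ∈ Subgroup.center G → ϕ ⟨x, hx⟩ = 1 := by
    intro x hx hc
    exact (QuotientGroup.eq_one_iff _).2 (Subgroup.mem_subgroupOf.2 hc)
  have hVA : ∀ (x : G) (hx : x ∈ A), V x = ϕ ⟨x, hx⟩ := by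
    intro x hx
    have : Fintype (Quotient (orbitRel (Subgroup.zpowers x) (G ⧸ A))) := Fintype.ofFinite _
    change MonoidHom.transfer ϕ x = _
    rw [MonoidHom.transfer_eq_prod_quotient_orbitRel_zpowers_quot]
    let q0 : Quotient (orbitRel (Subgroup.zpowers x) (G ⧸ A)) := Quotient.mk _ ((1 : G) : G ⧸ A)
    have hfix : x • ((1 : G) : G ⧸ A) = ((1 : G) : G ⧸ A) := by
      change ((x • (1 : G) : G) : G ⧸ A) = _
      rw [QuotientGroup.eq]; simpa using hx
    have hout : ∀ c : G ⧸ A, c.out ∈ A ↔ c = ((1 : G) : G ⧸ A) := by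
      intro c
      conv_rhs => rw [← QuotientGroup.out_eq' c, eq_comm, QuotientGroup.eq]
      simp
    rw [Fintype.prod_eq_single q0]
    · have h1 : q0.out = ((1 : G) : G ⧸ A) := by
        have : (orbitRel (Subgroup.zpowers x) (G ⧸ A)) q0.out ((1 : G) : G ⧸ A) :=
          Quotient.exact (Quotient.out_eq q0)
        obtain ⟨⟨y, hy⟩, hy'⟩ := this
        rw [← hy']
        obtain ⟨k, rfl⟩ := Subgroup.mem_zpowers_iff.1 hy
        change x ^ k • ((1 : G) : G ⧸ A) = _
        have : x ^ k ∈ stabilizer G ((1 : G) : G ⧸ A) :=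
          Subgroup.zpow_mem _ (mem_stabilizer_iff.2 hfix) k
        exact this
      have h2 : Function.minimalPeriod (x • ·) q0.out = 1 := by
        rw [Function.minimalPeriod_eq_one_iff_isFixedPt, h1]
        exact hfix
      congr 1
      apply Subtype.ext
      simp only [h2, pow_one]
      have := hcomm _ hx _ ((hout _).2 h1)
      rw [mul_assoc, this, inv_mul_cancel_left]
    · intro q hq
      have hn : q.out.out ∉ A := by
        rw [hout]
        intro h
        apply hq
        rw [← Quotient.out_eq q, h]
      apply hϕ
      have hc := mem_center_of_conj_mem hcomm hmax hA hn
        (QuotientGroup.out_conj_pow_minimalPeriod_mem A x q.out) (A.pow_mem hx _)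
      have h3 := Subgroup.mem_center_iff.1 hc q.out.out
      rw [mul_assoc, ← h3, inv_mul_cancel_left]
      exact hc
  obtain ⟨⟨⟨h', hh'⟩, ⟨z, hz⟩⟩, hxz⟩ := hH.2 (a⁻¹ * h * a)
  refine ⟨h', hh', z, hz, ?_, hxz.symm⟩
  have h1 : V (a⁻¹ * h * a) = 1 := by
    rw [map_mul, map_mul, hVH h hh, mul_one, ← map_mul, inv_mul_cancel, map_one]
  rw [← hxz] at h1
  simp only [map_mul, hVH h' hh', one_mul, hVA z hz] at h1
  exact Subgroup.mem_subgroupOf.1 ((QuotientGroup.eq_one_iff _).1 h1)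

/-- A proper subgroup of a finite additive group contains at most half of the elements. -/
theorem two_mul_card_le_of_ne_top {A : Type*} [AddGroup A] [Finite A] {F : AddSubgroup A}
    (hF : F ≠ ⊤) : 2 * Nat.card F ≤ Nat.card A := by
  rw [← F.card_mul_index, mul_comm]
  have h1 : F.index ≠ 1 := fun h => hF (AddSubgroup.index_eq_one.1 h)
  have h0 : F.index ≠ 0 := AddSubgroup.index_ne_zero_of_finite
  exact Nat.mul_le_mul_left _ (by omega)

theorem two_mul_card_sameCycle_quotient_le {α : Type*} [Fintype α] [DecidableEq α]
    (σ : Equiv.Perm α) :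
    2 * Nat.card (Quotient (Equiv.Perm.SameCycle.setoid σ)) ≤
      Nat.card α + Nat.card {x // σ x = x} := by
  let Q := Quotient (Equiv.Perm.SameCycle.setoid σ)
  have hout : ∀ c d : Q, σ.SameCycle c.out d.out → c = d := fun c d h => by
    rw [← Quotient.out_eq c, ← Quotient.out_eq d]; exact Quotient.sound h
  let f : Q ⊕ Q → α ⊕ {x // σ x = x} := Sum.elim (fun c => Sum.inl c.out)
    (fun c => if h : σ c.out = c.out then Sum.inr ⟨c.out, h⟩ else Sum.inl (σ c.out))
  have hf : Function.Injective f := by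
    have hmix : ∀ c d : Q, f (Sum.inl c) ≠ f (Sum.inr d) := by
      intro c d h
      by_cases hd : σ d.out = d.out
      · simp [f, hd] at h
      · simp only [Sum.elim_inl, Sum.elim_inr, hd, dite_false, Sum.inl.injEq, f] at h
        have : d = c := hout _ _ (h ▸ (Equiv.Perm.SameCycle.refl σ _).apply_right)
        subst this
        exact hd h.symm
    rintro (c | c) (d | d) h
    · simp only [Sum.elim_inl, Sum.inl.injEq, f] at h
      rw [hout c d (h ▸ Equiv.Perm.SameCycle.refl σ _)]
    · exact absurd h (hmix _ _)
    · exact absurd h.symm (hmix _ _)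
    · congr 1
      by_cases hc : σ c.out = c.out <;> by_cases hd : σ d.out = d.out
      · simp only [Sum.elim_inr, hc, hd, dite_true, Sum.inr.injEq, Subtype.mk.injEq, f] at h
        exact hout c d (h ▸ Equiv.Perm.SameCycle.refl σ _)
      · simp [f, hc, hd] at h
      · simp [f, hc, hd] at h
      · simp only [Sum.elim_inr, hc, hd, dite_false, Sum.inl.injEq, σ.injective.eq_iff, f] at h
        exact hout c d (h ▸ Equiv.Perm.SameCycle.refl σ _)
  have := Nat.card_le_card_of_injective f hf
  rw [Nat.card_sum, Nat.card_sum] at this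
  change 2 * Nat.card Q ≤ _
  omega

/-- A permutation fixing at most half of the points preserves few subsets. -/
theorem card_invariant_le {α : Type*} [Fintype α] [DecidableEq α]
    (σ : Equiv.Perm α) (hσ : 2 * Nat.card {x // σ x = x} ≤ Nat.card α) :
    {S : Finset α | ∀ x, σ x ∈ S ↔ x ∈ S}.ncard ≤ 2 ^ (3 * Nat.card α / 4) := by
  classical
  let Q := Quotient (Equiv.Perm.SameCycle.setoid σ)
  have hQ := two_mul_card_sameCycle_quotient_le σ
  let f : {S : Finset α | ∀ x, σ x ∈ S ↔ x ∈ S} → Set Q := fun S => {c | c.out ∈ S.1}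
  have hinv : ∀ S : Finset α, (∀ x, σ x ∈ S ↔ x ∈ S) → ∀ x y, σ.SameCycle x y →
      (x ∈ S ↔ y ∈ S) := by
    intro S hS x y hxy
    obtain ⟨k, -, rfl⟩ := hxy.exists_pow_eq'
    clear hxy
    induction k with
    | zero => simp
    | succ k ih => rw [pow_succ', Equiv.Perm.mul_apply, hS]; exact ih
  have hf : Function.Injective f := by
    rintro ⟨S, hS⟩ ⟨T, hT⟩ h
    apply Subtype.ext
    ext x
    have h1 : σ.SameCycle (Quotient.mk (Equiv.Perm.SameCycle.setoid σ) x).out x :=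
      Quotient.exact (s := Equiv.Perm.SameCycle.setoid σ) (Quotient.out_eq _)
    have h2 := Set.ext_iff.1 h (Quotient.mk _ x)
    change _ ∈ S ↔ _ ∈ T at h2
    rw [← hinv S hS _ _ h1, h2, hinv T hT _ _ h1]
  have h3 := Nat.card_le_card_of_injective f hf
  rw [Nat.card_coe_set_eq] at h3
  have h4 : Nat.card (Set Q) = 2 ^ Nat.card Q := by
    have : Fintype Q := Fintype.ofFinite _
    rw [Nat.card_eq_fintype_card, Nat.card_eq_fintype_card, Fintype.card_set]
  rw [h4] at h3
  refine h3.trans (Nat.pow_le_pow_right (by norm_num) ?_)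
  change 2 * Nat.card Q ≤ _ at hQ
  omega

theorem exists_nsmul_eq_of_prime_nsmul_eq_zero {A : Type*} [AddCommGroup A] [IsAddCyclic A]
    [Finite A] {p : ℕ} (hp : p.Prime) {t z : A} (ht : p • t = 0) (hz : p • z = 0) (hz0 : z ≠ 0) :
    ∃ j : ℕ, j • z = t := by
  classical
  have : Fintype A := Fintype.ofFinite A
  have : Fact p.Prime := ⟨hp⟩
  have hord : addOrderOf z = p := addOrderOf_eq_prime hz hz0
  have hsub : Finset.univ.filter (· ∈ AddSubgroup.zmultiples z) ⊆
      Finset.univ.filter (fun a : A => p • a = 0) := by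
    intro a ha
    simp only [Finset.mem_filter, Finset.mem_univ, true_and] at ha ⊢
    obtain ⟨k, rfl⟩ := AddSubgroup.mem_zmultiples_iff.1 ha
    rw [smul_comm, hz, smul_zero]
  have heq := Finset.eq_of_subset_of_card_le hsub (by
    refine (IsAddCyclic.card_nsmul_eq_zero_le hp.pos).trans ?_
    rw [← Fintype.card_subtype, ← Nat.card_eq_fintype_card]
    exact (hord.symm.trans (Nat.card_zmultiples z).symm).le)
  have : t ∈ Finset.univ.filter (· ∈ AddSubgroup.zmultiples z) := by
    rw [heq]; simp [ht]
  simp only [Finset.mem_filter, Finset.mem_univ, true_and] at this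
  rw [← mem_multiples_iff_mem_zmultiples] at this
  exact AddSubmonoid.mem_multiples_iff _ _ |>.1 this
/-- The group of translations of `Z_n`. -/
def translations (n : ℕ) : Subgroup (Equiv.Perm (ZMod n)) where
  carrier := {σ | ∀ x, σ x = x + σ 0}
  mul_mem' {a b} ha hb x := by
    simp only [Set.mem_ofPred_eq] at ha hb
    rw [Equiv.Perm.mul_apply, Equiv.Perm.mul_apply, hb, ha, ha (b 0), add_assoc]
  one_mem' x := by simp
  inv_mem' {a} ha x := by
    simp only [Set.mem_ofPred_eq] at ha
    apply a.injective
    rw [Equiv.Perm.inv_def, Equiv.apply_symm_apply, ha, add_assoc, ← ha, Equiv.apply_symm_apply,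
      add_zero]

/-- The automorphism group of `Cay(Z_n,S)`. -/
def cayAut (n : ℕ) (S : Finset (ZMod n)) : Subgroup (Equiv.Perm (ZMod n)) where
  carrier := {σ | ∀ x y, y - x ∈ S ↔ σ y - σ x ∈ S}
  mul_mem' {a b} ha hb x y := (hb x y).trans (ha _ _)
  one_mem' x y := Iff.rfl
  inv_mem' {a} ha x y := by
    simp only [Set.mem_ofPred_eq] at ha
    rw [ha (a⁻¹ x), Equiv.Perm.inv_def, Equiv.apply_symm_apply, Equiv.apply_symm_apply]

theorem addRight_mem_translations {n : ℕ} (a : ZMod n) :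
    (Equiv.addRight a : Equiv.Perm (ZMod n)) ∈ translations n := fun x => by simp

theorem translations_le_cayAut (n : ℕ) (S : Finset (ZMod n)) : translations n ≤ cayAut n S := by
  intro σ hσ x y
  rw [hσ x, hσ y, add_sub_add_right_eq_sub]

theorem card_translations (n : ℕ) [NeZero n] : Nat.card (translations n) = n := by
  refine (Nat.card_congr (Equiv.ofBijective
    (fun σ : translations n => σ.1 0) ⟨?_, ?_⟩)).trans (Nat.card_zmod n)
  · intro σ τ h
    apply Subtype.ext
    ext x
    rw [σ.2 x, τ.2 x]
    exact congrArg (x + ·) h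
  · intro a
    exact ⟨⟨_, addRight_mem_translations a⟩, by simp⟩

theorem translations_comm {n : ℕ} {σ τ : Equiv.Perm (ZMod n)} (hσ : σ ∈ translations n)
    (hτ : τ ∈ translations n) : σ * τ = τ * σ := by
  ext x
  rw [Equiv.Perm.mul_apply, Equiv.Perm.mul_apply, hσ, hτ, hτ (σ x), hσ x, add_right_comm]

/-- The permutations used to detect circulant digraphs with nonregular automorphism group:
multiplications by a constant, and translations outside of a subgroup. -/
def IsSpecialPerm {n : ℕ} (σ : Equiv.Perm (ZMod n)) : Prop :=
  (∃ c : ZMod n, ∀ x, σ x = c * x) ∨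
    ∃ m t : ZMod n, ∀ x, (x ∈ AddSubgroup.zmultiples m → σ x = x) ∧
      (x ∉ AddSubgroup.zmultiples m → σ x = x + t)

theorem exists_mul_of_normalizes {n : ℕ} [NeZero n] {σ : Equiv.Perm (ZMod n)} (h0 : σ 0 = 0)
    (hσ : σ * Equiv.addRight 1 * σ⁻¹ ∈ translations n) : ∃ c : ZMod n, ∀ x, σ x = c * x := by
  refine ⟨σ 1, fun x => ?_⟩
  have h0' : σ⁻¹ 0 = 0 := by rw [Equiv.Perm.inv_eq_iff_eq, h0]
  have key : ∀ y, σ (y + 1) = σ y + σ 1 := by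
    intro y
    have := hσ (σ y)
    simp only [Equiv.Perm.mul_apply, Equiv.Perm.inv_def, Equiv.symm_apply_apply] at this h0'
    rw [h0'] at this
    simpa using this
  have : ∀ k : ℕ, σ k = σ 1 * k := by
    intro k
    induction k with
    | zero => simp [h0]
    | succ k ih => push_cast; rw [key, ih, mul_add, mul_one]
  simpa using this x.val

theorem mul_perm_fixed_le {n : ℕ} [NeZero n] {σ : Equiv.Perm (ZMod n)} (h1 : σ ≠ 1) {c : ZMod n}
    (hσ : ∀ x, σ x = c * x) : 2 * Nat.card {x // σ x = x} ≤ n := by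
  let F : AddSubgroup (ZMod n) :=
    { carrier := {x | σ x = x}
      zero_mem' := by simp [hσ]
      add_mem' := fun {a b} ha hb => by
        simp only [Set.mem_ofPred_eq, hσ] at *
        rw [mul_add, ha, hb]
      neg_mem' := fun {a} ha => by
        simp only [Set.mem_ofPred_eq, hσ] at *
        rw [mul_neg, ha] }
  have hF : F ≠ ⊤ := fun h => h1 (Equiv.ext fun x => by
    have : x ∈ F := h ▸ AddSubgroup.mem_top x
    exact this)
  have := two_mul_card_le_of_ne_top hF
  rwa [Nat.card_zmod] at this

theorem exists_special_perm_of_shift {n : ℕ} [NeZero n] {S : Finset (ZMod n)}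
    {F : AddSubgroup (ZMod n)} (hF : F ≠ ⊤) {t : ZMod n} (ht : t ≠ 0)
    (hFt : ∀ x, x + t ∈ F ↔ x ∈ F) (hS : ∀ x ∉ F, x + t ∈ S ↔ x ∈ S) :
    ∃ σ : Equiv.Perm (ZMod n), IsSpecialPerm σ ∧ 2 * Nat.card {x // σ x = x} ≤ n ∧
      ∀ x, σ x ∈ S ↔ x ∈ S := by
  classical
  let f : ZMod n → ZMod n := fun x => if x ∈ F then x else x + t
  have hf : Function.Injective f := by
    intro x y h
    simp only [f] at h
    split_ifs at h with hx hy hy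
    · exact h
    · exact absurd ((hFt y).1 (h ▸ hx)) hy
    · exact absurd ((hFt x).1 (h ▸ hy)) hx
    · exact add_right_cancel h
  let σ : Equiv.Perm (ZMod n) := Equiv.ofBijective f (Finite.injective_iff_bijective.1 hf)
  have hσ1 : ∀ x ∈ F, σ x = x := fun x hx => if_pos hx
  have hσ2 : ∀ x ∉ F, σ x = x + t := fun x hx => if_neg hx
  refine ⟨σ, Or.inr ?_, ?_, ?_⟩
  · obtain ⟨m, hm⟩ := (AddSubgroup.isAddCyclic_iff_exists_zmultiples_eq_top F).1 inferInstance
    refine ⟨m, t, fun x => ?_⟩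
    rw [hm]
    exact ⟨hσ1 x, hσ2 x⟩
  · have h1 := two_mul_card_le_of_ne_top hF
    rw [Nat.card_zmod] at h1
    refine le_trans (Nat.mul_le_mul_left 2 ?_) h1
    refine Nat.card_le_card_of_injective (fun x => (⟨x.1, ?_⟩ : F)) ?_
    · by_contra hx
      have := x.2
      rw [hσ2 _ hx] at this
      exact ht (by simpa using this)
    · intro x y h
      exact Subtype.ext (congrArg (fun z : F => (z : ZMod n)) h)
  · intro x
    by_cases hx : x ∈ F
    · rw [hσ1 x hx]
    · rw [hσ2 x hx, hS x hx]

/-- Let `K` be a group of permutations in which the translations form a maximal, nonnormal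
subgroup. Then the point stabilizer acts by translations by central elements. -/
theorem exists_central_shift {n : ℕ} [NeZero n] {K : Subgroup (Equiv.Perm (ZMod n))}
    (hK : translations n ⋖ K) (hnn : ¬ ((translations n).subgroupOf K).Normal)
    {h : Equiv.Perm (ZMod n)} (hh : h ∈ K) (h0 : h 0 = 0) (a : ZMod n) :
    ∃ z, h a = a + z ∧ ∀ g ∈ K, ∀ x, g (x + z) = g x + z := by
  have hlt : ∀ x, (Equiv.addRight x : Equiv.Perm (ZMod n)) ∈ K := fun x =>
    hK.le (addRight_mem_translations x)
  let A := (translations n).subgroupOf K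
  let H := MulAction.stabilizer K (0 : ZMod n)
  have hcompl : H.IsComplement' A := by
    refine (Subgroup.isComplement'_stabilizer (0 : ZMod n) ?_ ?_).symm
    · rintro ⟨⟨g, hgK⟩, hg⟩ hg0
      have hg' : g ∈ translations n := Subgroup.mem_subgroupOf.1 hg
      have hg0' : g 0 = 0 := hg0
      apply Subtype.ext
      apply Subtype.ext
      ext x
      change g x = x
      rw [hg' x, hg0', add_zero]
    · rintro ⟨g, hgK⟩
      refine ⟨⟨⟨Equiv.addRight (-(g 0)), hlt _⟩,
        Subgroup.mem_subgroupOf.2 (addRight_mem_translations _)⟩, ?_⟩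
      change g 0 + -(g 0) = 0
      simp
  have hmax : IsCoatom A := by
    constructor
    · intro htop
      exact hK.lt.not_ge (Subgroup.subgroupOf_eq_top.1 htop)
    · intro B hB
      have h1 : translations n < B.map K.subtype := by
        have h2 : A.map K.subtype < B.map K.subtype :=
          (Subgroup.map_lt_map_iff_of_injective K.subtype_injective).2 hB
        rwa [Subgroup.map_subgroupOf_eq_of_le hK.le] at h2
      have h3 : B.map K.subtype = K :=
        (hK.eq_or_eq h1.le (Subgroup.map_subtype_le B)).resolve_left h1.ne'
      rw [eq_top_iff]
      intro k _
      have : (k : Equiv.Perm (ZMod n)) ∈ B.map K.subtype := by rw [h3]; exact k.2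
      obtain ⟨b, hb, hbk⟩ := this
      rwa [← Subtype.ext (hbk : (b : Equiv.Perm (ZMod n)) = k)]
  have hcomm : ∀ x ∈ A, ∀ y ∈ A, x * y = y * x := fun x hx y hy =>
    Subtype.ext (translations_comm (Subgroup.mem_subgroupOf.1 hx) (Subgroup.mem_subgroupOf.1 hy))
  obtain ⟨⟨h', hh'K⟩, hh', ⟨z, hzK⟩, hzA, hzc, hz⟩ :=
    exists_conj_eq_mul_center (a := ⟨Equiv.addRight a, hlt a⟩) (h := ⟨h, hh⟩)
      hcomm hmax hnn hcompl (MulAction.mem_stabilizer_iff.2 h0)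
  have hz' : (Equiv.addRight a : Equiv.Perm (ZMod n))⁻¹ * h * Equiv.addRight a = h' * z :=
    congrArg Subtype.val hz
  have hh'0 : h' 0 = 0 := hh'
  have hzt : z ∈ translations n := Subgroup.mem_subgroupOf.1 hzA
  have hzcomm : ∀ g ∈ K, ∀ x, g (z x) = z (g x) := fun g hg x =>
    congrArg (fun k : K => (k : Equiv.Perm (ZMod n)) x) (Subgroup.mem_center_iff.1 hzc ⟨g, hg⟩)
  refine ⟨z 0, ?_, fun g hg x => by rw [← hzt x, hzcomm g hg, hzt (g x)]⟩
  have h1 := congrArg (fun σ : Equiv.Perm (ZMod n) => (Equiv.addRight a : Equiv.Perm (ZMod n)) (σ 0)) hz'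
  simp only [Equiv.Perm.mul_apply, Equiv.Perm.inv_def,
    Equiv.apply_symm_apply] at h1
  rw [hzcomm h' hh'K, hh'0] at h1
  simpa [add_comm] using h1

theorem exists_special_perm {n : ℕ} [NeZero n] {S : Finset (ZMod n)}
    (hS : cayAut n S ≠ translations n) :
    ∃ σ : Equiv.Perm (ZMod n), IsSpecialPerm σ ∧ 2 * Nat.card {x // σ x = x} ≤ n ∧
      ∀ x, σ x ∈ S ↔ x ∈ S := by
  obtain ⟨K, hK, hKS⟩ :=
    ((translations_le_cayAut n S).lt_of_ne hS.symm).exists_covby_le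
  have hlt : ∀ x, (Equiv.addRight x : Equiv.Perm (ZMod n)) ∈ K := fun x =>
    hK.le (addRight_mem_translations x)
  have hinv : ∀ g ∈ K, g 0 = 0 → ∀ x, g x ∈ S ↔ x ∈ S := by
    intro g hg h0 x
    have := hKS hg 0 x
    rw [h0, sub_zero, sub_zero] at this
    exact this.symm
  obtain ⟨h, hh, h0, h1⟩ : ∃ h ∈ K, h 0 = 0 ∧ h ≠ 1 := by
    obtain ⟨g, hg, hgt⟩ := SetLike.exists_of_lt hK.lt
    refine ⟨Equiv.addRight (-(g 0)) * g, K.mul_mem (hlt _) hg, by simp, fun h => hgt ?_⟩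
    rw [mul_eq_one_iff_inv_eq] at h
    rw [← h]
    exact Subgroup.inv_mem _ (addRight_mem_translations _)
  by_cases hn : ((translations n).subgroupOf K).Normal
  · obtain ⟨c, hc⟩ := exists_mul_of_normalizes h0 (by
      have := hn.conj_mem ⟨Equiv.addRight 1, hlt 1⟩
        (Subgroup.mem_subgroupOf.2 (addRight_mem_translations 1)) ⟨h, hh⟩
      exact Subgroup.mem_subgroupOf.1 this)
    exact ⟨h, Or.inl ⟨c, hc⟩, mul_perm_fixed_le h1 hc, hinv h hh h0⟩
  have shift := fun {g : Equiv.Perm (ZMod n)} => exists_central_shift hK hn (h := g)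
  let H := MulAction.stabilizer K (0 : ZMod n)
  have hH : Nat.card H ≠ 1 := by
    intro hc
    have := (Subgroup.eq_bot_of_card_eq _ hc)
    have h2 : (⟨h, hh⟩ : K) ∈ H := h0
    rw [this, Subgroup.mem_bot] at h2
    exact h1 (congrArg Subtype.val h2)
  obtain ⟨p, hp, hpd⟩ := Nat.exists_prime_and_dvd hH
  have : Fact p.Prime := ⟨hp⟩
  obtain ⟨⟨⟨k, hkK⟩, hk0⟩, hkord⟩ := exists_prime_orderOf_dvd_card' p hpd
  replace hk0 : k 0 = 0 := hk0
  have hkp : k ^ p = 1 := by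
    have := pow_orderOf_eq_one (⟨⟨k, hkK⟩, hk0⟩ : H)
    rw [hkord] at this
    exact congrArg (fun x : H => (x.1.1 : Equiv.Perm (ZMod n))) this
  have hk1 : k ≠ 1 := by
    rintro rfl
    have : (⟨⟨1, hkK⟩, hk0⟩ : H) = 1 := rfl
    rw [this, orderOf_one] at hkord
    exact hp.one_lt.ne hkord
  let M : Set (Equiv.Perm (ZMod n)) := {g | g ∈ K ∧ g 0 = 0 ∧ g ^ p = 1}
  have hadd : ∀ x y, (∀ g ∈ M, g x = x) → (∀ g ∈ M, g y = y) → ∀ g ∈ M, g (x + y) = x + y := by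
    intro x y hx hy g hg
    let τ : Equiv.Perm (ZMod n) := Equiv.addRight x
    have hτ : ∀ u, τ u = u + x := fun u => rfl
    have hmem : τ⁻¹ * g * τ ∈ M := by
      refine ⟨K.mul_mem (K.mul_mem (K.inv_mem (hlt x)) hg.1) (hlt x), ?_, ?_⟩
      · rw [Equiv.Perm.mul_apply, Equiv.Perm.mul_apply, hτ, zero_add, hx g hg,
          Equiv.Perm.inv_eq_iff_eq, hτ, zero_add]
      · have := conj_pow (i := p) (a := τ⁻¹) (b := g)
        rw [inv_inv] at this
        rw [this, hg.2.2, mul_one, inv_mul_cancel]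
    have := hy _ hmem
    rw [Equiv.Perm.mul_apply, Equiv.Perm.mul_apply, Equiv.Perm.inv_eq_iff_eq, hτ] at this
    rw [add_comm x y, this]
  have hsmul : ∀ x, (∀ g ∈ M, g x = x) → ∀ j : ℕ, ∀ g ∈ M, g (j • x) = j • x := by
    intro x hx j
    induction j with
    | zero => intro g hg; rw [zero_smul, hg.2.1]
    | succ j ih => rw [succ_nsmul]; exact hadd _ _ ih hx
  let F : AddSubgroup (ZMod n) :=
    { carrier := {x | ∀ g ∈ M, g x = x}
      zero_mem' := fun g hg => hg.2.1
      add_mem' := fun {x y} hx hy => hadd x y hx hy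
      neg_mem' := fun {x} hx => by
        have : -x = (n - 1) • x := by
          rw [neg_eq_iff_add_eq_zero, ← succ_nsmul', Nat.sub_add_cancel NeZero.one_le]
          simp
        rw [this]
        exact hsmul x hx _ }
  have hpow : ∀ g : Equiv.Perm (ZMod n), ∀ x z, g x = x + z → (∀ y, g (y + z) = g y + z) →
      ∀ j : ℕ, (g ^ j) x = x + j • z := by
    intro g x z hx hz j
    induction j with
    | zero => simp
    | succ j ih =>
      have hz' : ∀ i : ℕ, g (x + i • z) = g x + i • z := by
        intro i
        induction i with
        | zero => simp
        | succ i ih => rw [succ_nsmul, ← add_assoc, hz, ih, add_assoc]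
      rw [pow_succ', Equiv.Perm.mul_apply, ih, hz', hx, succ_nsmul', add_assoc]
  have hmove : ∀ g ∈ M, ∀ x, g x ≠ x → ∃ z, z ≠ 0 ∧ p • z = 0 ∧ g x = x + z ∧
      ∀ g ∈ K, ∀ y, g (y + z) = g y + z := by
    intro g hg x hx
    obtain ⟨z, hz, hzc⟩ := shift hg.1 hg.2.1 x
    refine ⟨z, ?_, ?_, hz, hzc⟩
    · rintro rfl
      exact hx (by rw [hz, add_zero])
    · have := hpow g x z hz (hzc g hg.1) p
      rw [hg.2.2, Equiv.Perm.one_apply] at this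
      simpa using this.symm
  obtain ⟨x₀, hx₀⟩ : ∃ x, k x ≠ x := by
    by_contra! hc
    exact hk1 (Equiv.ext hc)
  obtain ⟨t, ht0, hpt, -, htc⟩ := hmove k ⟨hkK, hk0, hkp⟩ x₀ hx₀
  refine exists_special_perm_of_shift (F := F) (t := t) ?_ ht0 ?_ ?_
  · intro htop
    have : x₀ ∈ F := htop ▸ AddSubgroup.mem_top _
    exact hx₀ (this k ⟨hkK, hk0, hkp⟩)
  · intro x
    refine forall₂_congr fun g hg => ?_
    rw [htc g hg.1, add_left_inj]
  · intro x hx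
    obtain ⟨g, hg, hgx⟩ : ∃ g ∈ M, g x ≠ x := by
      by_contra! hc
      exact hx hc
    obtain ⟨z, hz0, hpz, hgz, hzc⟩ := hmove g hg x hgx
    obtain ⟨j, hj⟩ := exists_nsmul_eq_of_prime_nsmul_eq_zero hp hpt hpz hz0
    have h2 := hpow g x z hgz (hzc g hg.1) j
    rw [hj] at h2
    rw [← h2]
    refine hinv _ (K.pow_mem hg.1 j) ?_ x
    exact (MulAction.stabilizer (Equiv.Perm (ZMod n)) (0 : ZMod n)).pow_mem hg.2.1 j

theorem ncard_le_mul_ncard_image {α β : Type*} [Finite α] (s : Set α) (f : α → β) (k : ℕ)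
    (h : ∀ a ∈ s, {x ∈ s | f x = f a}.ncard ≤ k) : s.ncard ≤ k * (f '' s).ncard := by
  classical
  have : Fintype α := Fintype.ofFinite α
  rw [Set.ncard_eq_toFinset_card' s, Set.ncard_eq_toFinset_card' (f '' s), Set.toFinset_image]
  refine Finset.card_le_mul_card_image _ _ fun b hb => ?_
  obtain ⟨a, ha, rfl⟩ := Finset.mem_image.1 hb
  refine le_trans (le_of_eq ?_) (h a (Set.mem_toFinset.1 ha))
  rw [← Set.ncard_coe_finset]
  congr 1
  ext x
  simp

theorem mul_ncard_image_le_ncard {α β : Type*} [Finite α] (s : Set α) (f : α → β) (k : ℕ)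
    (h : ∀ a ∈ s, k ≤ {x ∈ s | f x = f a}.ncard) : k * (f '' s).ncard ≤ s.ncard := by
  classical
  have : Fintype α := Fintype.ofFinite α
  rw [Set.ncard_eq_toFinset_card' s, Set.ncard_eq_toFinset_card' (f '' s), Set.toFinset_image]
  refine Finset.mul_card_image_le_card _ _ fun b hb => ?_
  obtain ⟨a, ha, rfl⟩ := Finset.mem_image.1 hb
  refine (h a (Set.mem_toFinset.1 ha)).trans (le_of_eq ?_)
  rw [← Set.ncard_coe_finset]
  congr 1
  ext x
  simp

theorem ncard_specialPerm_le (n : ℕ) [NeZero n] :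
    {σ : Equiv.Perm (ZMod n) | IsSpecialPerm σ}.ncard ≤ 2 * n ^ 2 := by
  classical
  have h1 : {σ : Equiv.Perm (ZMod n) | ∃ c : ZMod n, ∀ x, σ x = c * x}.ncard ≤ n := by
    rw [← Nat.card_coe_set_eq]
    conv_rhs => rw [← Nat.card_zmod n]
    refine Nat.card_le_card_of_injective (fun σ => σ.2.choose) fun σ τ h => ?_
    apply Subtype.ext
    ext x
    rw [σ.2.choose_spec, τ.2.choose_spec]
    exact congrArg (· * x) h
  have h2 : {σ : Equiv.Perm (ZMod n) | ∃ d : ZMod n × ZMod n, ∀ x,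
      (x ∈ AddSubgroup.zmultiples d.1 → σ x = x) ∧
      (x ∉ AddSubgroup.zmultiples d.1 → σ x = x + d.2)}.ncard ≤ n * n := by
    rw [← Nat.card_coe_set_eq]
    have h3 : n * n = Nat.card (ZMod n × ZMod n) := by rw [Nat.card_prod, Nat.card_zmod]
    rw [h3]
    refine Nat.card_le_card_of_injective (fun σ => σ.2.choose) fun σ τ h => ?_
    apply Subtype.ext
    ext x
    have hs := σ.2.choose_spec x
    have ht := τ.2.choose_spec x
    simp only at h
    rw [h] at hs
    by_cases hx : x ∈ AddSubgroup.zmultiples τ.2.choose.1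
    · rw [hs.1 hx, ht.1 hx]
    · rw [hs.2 hx, ht.2 hx]
  have h3 : {σ : Equiv.Perm (ZMod n) | IsSpecialPerm σ} ⊆ _ ∪ _ :=
    fun σ hσ => hσ.imp id fun ⟨m, t, h⟩ => (⟨(m, t), h⟩ : ∃ d : ZMod n × ZMod n, ∀ x,
      (x ∈ AddSubgroup.zmultiples d.1 → σ x = x) ∧
      (x ∉ AddSubgroup.zmultiples d.1 → σ x = x + d.2))
  have h4 := (Set.ncard_le_ncard h3).trans (Set.ncard_union_le _ _)
  have h5 : n ≤ n * n := Nat.le_mul_self n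
  calc _ ≤ n + n * n := h4.trans (add_le_add h1 h2)
    _ ≤ 2 * n ^ 2 := by rw [pow_two]; omega

/-- Few circulant digraphs have an automorphism group larger than the group of translations. -/
theorem ncard_cayAut_ne_translations_le (n : ℕ) [NeZero n] :
    {S : Finset (ZMod n) | cayAut n S ≠ translations n}.ncard ≤
      2 * n ^ 2 * 2 ^ (3 * n / 4) := by
  classical
  let P : Finset (Equiv.Perm (ZMod n)) := Finset.univ.filter fun σ =>
    IsSpecialPerm σ ∧ 2 * Nat.card {x // σ x = x} ≤ n
  let I : Equiv.Perm (ZMod n) → Finset (Finset (ZMod n)) := fun σ =>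
    Finset.univ.filter fun S => ∀ x, σ x ∈ S ↔ x ∈ S
  have hsub : {S : Finset (ZMod n) | cayAut n S ≠ translations n} ⊆ (P.biUnion I : Finset _) := by
    intro S hS
    obtain ⟨σ, h1, h2, h3⟩ := exists_special_perm hS
    exact Finset.mem_coe.2 (Finset.mem_biUnion.2 ⟨σ, Finset.mem_filter.2
      ⟨Finset.mem_univ _, h1, h2⟩, Finset.mem_filter.2 ⟨Finset.mem_univ _, h3⟩⟩)
  refine (Set.ncard_le_ncard hsub).trans ?_
  rw [Set.ncard_coe_finset]
  refine (Finset.card_biUnion_le_card_mul _ _ (2 ^ (3 * n / 4)) fun σ hσ => ?_).trans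
    (Nat.mul_le_mul_right _ ?_)
  · have := card_invariant_le σ (by rw [Nat.card_zmod]; exact (Finset.mem_filter.1 hσ).2.2)
    rw [Nat.card_zmod] at this
    refine le_trans (le_of_eq ?_) this
    rw [← Set.ncard_coe_finset]
    simp [I]
  · refine le_trans ?_ (ncard_specialPerm_le n)
    rw [← Set.ncard_coe_finset]
    refine Set.ncard_le_ncard fun σ hσ => ?_
    exact (Finset.mem_filter.1 hσ).2.1

theorem CayIso.refl {n : ℕ} (S : Finset (ZMod n)) : CayIso n S S :=
  ⟨Equiv.refl _, fun _ _ => Iff.rfl⟩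

theorem CayIso.symm {n : ℕ} {S T : Finset (ZMod n)} : CayIso n S T → CayIso n T S :=
  fun ⟨φ, h⟩ => ⟨φ.symm, fun x y => by rw [h]; simp⟩

theorem CayIso.trans {n : ℕ} {S T U : Finset (ZMod n)} :
    CayIso n S T → CayIso n T U → CayIso n S U :=
  fun ⟨φ, h⟩ ⟨ψ, h'⟩ => ⟨φ.trans ψ, fun x y => (h x y).trans (h' _ _)⟩

theorem cayIso_class_eq_iff {n : ℕ} {S T : Finset (ZMod n)} :
    {U | CayIso n S U} = {U | CayIso n T U} ↔ CayIso n S T := by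
  constructor
  · intro h
    exact (Set.ext_iff.1 h T).2 (CayIso.refl T)
  · intro h
    ext U
    exact ⟨h.symm.trans, h.trans⟩

/-- The isomorphism class of a circulant digraph has at most as many connection sets as the
digraph has automorphisms. -/
theorem ncard_cayIso_le {n : ℕ} [NeZero n] (S : Finset (ZMod n)) :
    {T | CayIso n S T}.ncard ≤ Nat.card (cayAut n S) := by
  have h0 : ∀ T : {T | CayIso n S T}, ∃ φ : ZMod n ≃ ZMod n, φ 0 = 0 ∧
      ∀ x y, y - x ∈ S ↔ φ y - φ x ∈ T.1 := by
    rintro ⟨T, φ, hφ⟩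
    exact ⟨φ.trans (Equiv.addRight (-(φ 0))), by simp, fun x y => by simpa using hφ x y⟩
  choose φ hφ0 hφ using h0
  let c : {T | CayIso n S T} → Equiv.Perm (ZMod n) := fun T =>
    (φ T).trans ((Equiv.addRight 1).trans (φ T).symm)
  have hc : ∀ T, c T ∈ cayAut n S := by
    intro T x y
    rw [hφ T, hφ T]
    simp [c]
  have hpow : ∀ (T) (k : ℕ), φ T ((c T ^ k) 0) = k := by
    intro T k
    induction k with
    | zero => simp [hφ0]
    | succ k ih =>
      rw [pow_succ', Equiv.Perm.mul_apply]
      simp [c] at ih ⊢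
      rw [ih]
  have hmem : ∀ (T) (k : ℕ), (k : ZMod n) ∈ T.1 ↔ (c T ^ k) 0 ∈ S := by
    intro T k
    have := hφ T 0 ((c T ^ k) 0)
    rw [hpow, hφ0, sub_zero, sub_zero] at this
    exact this.symm
  rw [← Nat.card_coe_set_eq]
  refine Nat.card_le_card_of_injective (fun T => (⟨c T, hc T⟩ : cayAut n S)) fun T U h => ?_
  apply Subtype.ext
  ext x
  have h' : c T = c U := congrArg Subtype.val h
  have h1 := hmem T x.val
  rw [h', ← hmem U] at h1
  simpa using h1

theorem ncard_copies_mul_card_cayAut (n : ℕ) [NeZero n] (T : Finset (ZMod n)) :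
    {E | IsLabeledCopy n E T}.ncard * Nat.card (cayAut n T) = n.factorial := by
  have h1 : Nat.card (Fin n ≃ ZMod n) = n.factorial := by
    rw [Nat.card_congr (Equiv.equivCongr (Equiv.refl (Fin n)) (ZMod.finEquiv n).symm.toEquiv),
      Nat.card_eq_fintype_card, Fintype.card_perm, Fintype.card_fin]
  rw [← h1, ← Nat.card_coe_set_eq, ← Nat.card_prod]
  choose φ hφ using fun E : {E | IsLabeledCopy n E T} => E.2
  refine Nat.card_congr (Equiv.ofBijective (fun p => (φ p.1).trans p.2.1) ⟨?_, ?_⟩)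
  · rintro ⟨E, σ⟩ ⟨E', τ⟩ h
    simp only at h
    have hE : E = E' := by
      apply Subtype.ext
      ext ⟨x, y⟩
      have h1 := hφ E x y
      have h2 := hφ E' x y
      rw [σ.2 (φ E x)] at h1
      rw [τ.2 (φ E' x)] at h2
      have h3 : ∀ x, σ.1 (φ E x) = τ.1 (φ E' x) := fun x => Equiv.congr_fun h x
      rw [h1, h2, h3, h3]
    subst hE
    refine Prod.ext rfl (Subtype.ext (Equiv.ext fun x => ?_))
    have := Equiv.congr_fun h ((φ E).symm x)
    simpa using this
  · intro ψ
    let E : {E | IsLabeledCopy n E T} := ⟨{p | ψ p.2 - ψ p.1 ∈ T}, ψ, fun x y => Iff.rfl⟩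
    refine ⟨⟨E, ⟨(φ E).symm.trans ψ, fun x y => ?_⟩⟩, ?_⟩
    · have := hφ E ((φ E).symm x) ((φ E).symm y)
      rw [Equiv.apply_symm_apply, Equiv.apply_symm_apply] at this
      exact this.symm
    · ext x
      simp

theorem le_card_cayAut (n : ℕ) [NeZero n] (S : Finset (ZMod n)) : n ≤ Nat.card (cayAut n S) := by
  conv_lhs => rw [← card_translations n]
  exact Subgroup.card_le_of_le (translations_le_cayAut n S)

theorem ncard_copies_le (n : ℕ) [NeZero n] (S : Finset (ZMod n)) :
    {E | IsLabeledCopy n E S}.ncard ≤ (n - 1).factorial := by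
  have h := ncard_copies_mul_card_cayAut n S
  rw [← Nat.mul_factorial_pred (NeZero.ne n)] at h
  refine Nat.le_of_mul_le_mul_left ?_ (NeZero.pos n)
  rw [← h, mul_comm]
  exact Nat.mul_le_mul_left _ (le_card_cayAut n S)

theorem ncard_copies_eq (n : ℕ) [NeZero n] {S : Finset (ZMod n)}
    (hS : cayAut n S = translations n) :
    {E | IsLabeledCopy n E S}.ncard = (n - 1).factorial := by
  have h := ncard_copies_mul_card_cayAut n S
  rw [← Nat.mul_factorial_pred (NeZero.ne n), hS, card_translations, mul_comm] at h
  exact Nat.eq_of_mul_eq_mul_left (NeZero.pos n) h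

theorem IsLabeledCopy.class_eq {n : ℕ} {E : Set (Fin n × Fin n)} {S : Finset (ZMod n)}
    (h : IsLabeledCopy n E S) : {T | IsLabeledCopy n E T} = {T | CayIso n S T} := by
  obtain ⟨φ, hφ⟩ := h
  ext T
  constructor
  · rintro ⟨ψ, hψ⟩
    refine ⟨φ.symm.trans ψ, fun x y => ?_⟩
    have := hφ (φ.symm x) (φ.symm y)
    rw [Equiv.apply_symm_apply, Equiv.apply_symm_apply] at this
    rw [← this, hψ]
    rfl
  · rintro ⟨ψ, hψ⟩
    exact ⟨φ.trans ψ, fun x y => (hφ x y).trans (hψ _ _)⟩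

theorem image_class_copies {n : ℕ} [NeZero n] (R : Set (Finset (ZMod n))) :
    (fun E => {T | IsLabeledCopy n E T}) '' {E | ∃ T ∈ R, IsLabeledCopy n E T} =
      (fun S => {T | CayIso n S T}) '' R := by
  ext c
  constructor
  · rintro ⟨E, ⟨T, hT, hE⟩, rfl⟩
    exact ⟨T, hT, hE.class_eq.symm⟩
  · rintro ⟨T, hT, rfl⟩
    let φ : Fin n ≃ ZMod n := (ZMod.finEquiv n).toEquiv
    have : IsLabeledCopy n {p | φ p.2 - φ p.1 ∈ T} T := ⟨φ, fun x y => Iff.rfl⟩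
    exact ⟨_, ⟨T, hT, this⟩, this.class_eq⟩

theorem fiber_class_copies {n : ℕ} {R : Set (Finset (ZMod n))} {S : Finset (ZMod n)} (hS : S ∈ R)
    {E : Set (Fin n × Fin n)} (hE : IsLabeledCopy n E S) :
    {E' ∈ {E | ∃ T ∈ R, IsLabeledCopy n E T} |
      {T | IsLabeledCopy n E' T} = {T | IsLabeledCopy n E T}} = {E' | IsLabeledCopy n E' S} := by
  ext E'
  constructor
  · rintro ⟨-, h⟩
    exact (Set.ext_iff.1 h S).2 hE
  · intro h
    exact ⟨⟨S, hS, h⟩, h.class_eq.trans hE.class_eq.symm⟩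

theorem ncard_labeled_le (n : ℕ) [NeZero n] (R : Set (Finset (ZMod n))) :
    {E | ∃ T ∈ R, IsLabeledCopy n E T}.ncard ≤ (n - 1).factorial * numIsoClasses n R := by
  rw [numIsoClasses, ← image_class_copies]
  refine ncard_le_mul_ncard_image _ _ _ ?_
  rintro E ⟨S, hS, hE⟩
  rw [fiber_class_copies hS hE]
  exact ncard_copies_le n S

theorem le_ncard_labeled (n : ℕ) [NeZero n] (R : Set (Finset (ZMod n)))
    (hR : ∀ S ∈ R, cayAut n S = translations n) :
    (n - 1).factorial * numIsoClasses n R ≤ {E | ∃ T ∈ R, IsLabeledCopy n E T}.ncard := by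
  rw [numIsoClasses, ← image_class_copies]
  refine mul_ncard_image_le_ncard _ _ _ ?_
  rintro E ⟨S, hS, hE⟩
  rw [fiber_class_copies hS hE]
  exact (ncard_copies_eq n (hR S hS)).ge

theorem numIsoClasses_mono {n : ℕ} [NeZero n] {R R' : Set (Finset (ZMod n))} (h : R ⊆ R') :
    numIsoClasses n R ≤ numIsoClasses n R' :=
  Set.ncard_le_ncard (Set.image_mono h)

theorem ncard_le_mul_numIsoClasses (n : ℕ) [NeZero n] (R : Set (Finset (ZMod n)))
    (hR : ∀ S ∈ R, cayAut n S = translations n) : R.ncard ≤ n * numIsoClasses n R := by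
  refine ncard_le_mul_ncard_image _ _ _ fun S hS => ?_
  have h := ncard_cayIso_le S
  rw [hR S hS, card_translations] at h
  refine (Set.ncard_le_ncard ?_).trans h
  rintro T ⟨-, hT⟩
  exact (cayIso_class_eq_iff.1 hT).symm

/-- The number of isomorphism classes in `R` is controlled by the number of labeled copies. -/
theorem factorial_mul_numIsoClasses_le (n : ℕ) [NeZero n] (R : Set (Finset (ZMod n))) :
    (n - 1).factorial * numIsoClasses n R ≤ {E | ∃ T ∈ R, IsLabeledCopy n E T}.ncard +
      (n - 1).factorial * {S : Finset (ZMod n) | cayAut n S ≠ translations n}.ncard := by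
  let B := {S : Finset (ZMod n) | cayAut n S ≠ translations n}
  have h1 : numIsoClasses n R ≤ numIsoClasses n (R \ B) + B.ncard := by
    have : R ⊆ (R \ B) ∪ B := by rw [Set.sdiff_union_self]; exact Set.subset_union_left
    refine (numIsoClasses_mono this).trans ?_
    rw [numIsoClasses, Set.image_union]
    exact (Set.ncard_union_le _ _).trans (Nat.add_le_add_left (Set.ncard_image_le) _)
  refine (Nat.mul_le_mul_left _ h1).trans ?_
  rw [mul_add]
  refine Nat.add_le_add_right ((le_ncard_labeled n (R \ B) fun S hS => ?_).trans
    (Set.ncard_le_ncard ?_)) _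
  · exact not_not.1 hS.2
  · rintro E ⟨T, hT, hE⟩
    exact ⟨T, hT.1, hE⟩

theorem two_pow_le_mul_numIsoClasses_add (n : ℕ) [NeZero n] :
    2 ^ (n - 1) ≤ n * numIsoClasses n {S : Finset (ZMod n) | (0 : ZMod n) ∉ S} +
      {S : Finset (ZMod n) | cayAut n S ≠ translations n}.ncard := by
  classical
  let C := {S : Finset (ZMod n) | (0 : ZMod n) ∉ S}
  let B := {S : Finset (ZMod n) | cayAut n S ≠ translations n}
  have hC : C.ncard = 2 ^ (n - 1) := by
    have : C = ((Finset.univ.erase (0 : ZMod n)).powerset : Finset _) := by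
      ext S
      rw [Finset.mem_coe, Finset.mem_powerset, Finset.subset_erase]
      simp [C]
    rw [this, Set.ncard_coe_finset, Finset.card_powerset, Finset.card_erase_of_mem
      (Finset.mem_univ _), Finset.card_univ, ZMod.card]
  have h1 : C.ncard ≤ (C \ B).ncard + B.ncard := by
    refine (Set.ncard_le_ncard ?_).trans (Set.ncard_union_le _ _)
    rw [Set.sdiff_union_self]; exact Set.subset_union_left
  rw [← hC]
  refine h1.trans (Nat.add_le_add_right ((ncard_le_mul_numIsoClasses n (C \ B)
    fun S hS => not_not.1 hS.2).trans (Nat.mul_le_mul_left _ ?_)) _)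
  exact numIsoClasses_mono Set.sdiff_subset

theorem exists_threshold {ε : ℝ} (hε : 0 < ε) : ∃ N : ℕ, ∀ n : ℕ, N ≤ n → 1 ≤ n ∧
    8 * (n : ℝ) ^ 3 ≤ 2 ^ (ε * n) ∧ 8 * (n : ℝ) ^ 2 ≤ 2 ^ ((1 / 4 : ℝ) * n) := by
  have key : ∀ (δ : ℝ), 0 < δ → ∀ k : ℕ, ∀ᶠ n : ℕ in Filter.atTop,
      8 * (n : ℝ) ^ k ≤ 2 ^ (δ * n) := by
    intro δ hδ k
    have hr : 1 < (2 : ℝ) ^ δ := Real.one_lt_rpow (by norm_num) hδ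
    have h := tendsto_pow_const_div_const_pow_of_one_lt k hr
    filter_upwards [h.eventually (gt_mem_nhds (show (0 : ℝ) < 1 / 8 by norm_num))] with n hn
    rw [div_lt_iff₀ (by positivity)] at hn
    rw [Real.rpow_mul (by norm_num), Real.rpow_natCast]
    linarith
  obtain ⟨N, hN⟩ := Filter.eventually_atTop.1
    ((key ε hε 3).and ((key (1 / 4) (by norm_num) 2).and (Filter.eventually_ge_atTop 1)))
  exact ⟨N, fun n hn => ⟨(hN n hn).2.2, (hN n hn).1, (hN n hn).2.1⟩⟩

theorem div_le_two_rpow {ε : ℝ} {n B u : ℕ} (hn : 1 ≤ n)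
    (hn3 : 8 * (n : ℝ) ^ 3 ≤ 2 ^ (ε * n)) (hn2 : 8 * (n : ℝ) ^ 2 ≤ 2 ^ ((1 / 4 : ℝ) * n))
    (hB : B ≤ 2 * n ^ 2 * 2 ^ (3 * n / 4)) (hu : 2 ^ (n - 1) ≤ n * u + B) :
    (B : ℝ) / u ≤ 2 ^ ((-(1 / 4 : ℝ) + ε) * n) := by
  have hn0 : (0 : ℝ) < n := by exact_mod_cast hn
  have hWpos : (0 : ℝ) < 2 ^ ((3 / 4 : ℝ) * n) := by positivity
  have hqpos : (0 : ℝ) < 2 ^ ((-(1 / 4 : ℝ) + ε) * n) := by positivity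
  have hfloor : (2 : ℝ) ^ (3 * n / 4) ≤ 2 ^ ((3 / 4 : ℝ) * n) := by
    rw [← Real.rpow_natCast]
    refine Real.rpow_le_rpow_of_exponent_le (by norm_num) ?_
    have h := Nat.cast_div_le (α := ℝ) (m := 3 * n) (n := 4)
    push_cast at h
    linarith
  have hYW : (2 : ℝ) ^ ((1 / 4 : ℝ) * n) * 2 ^ ((3 / 4 : ℝ) * n) = 2 * 2 ^ (n - 1) := by
    rw [← Real.rpow_add (by norm_num), ← pow_succ', Nat.sub_add_cancel hn, ← Real.rpow_natCast]
    congr 1; ring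
  have hqY : (2 : ℝ) ^ ((-(1 / 4 : ℝ) + ε) * n) * 2 ^ ((1 / 4 : ℝ) * n) = 2 ^ (ε * n) := by
    rw [← Real.rpow_add (by norm_num)]
    congr 1; ring
  have hB' : (B : ℝ) ≤ 2 * n ^ 2 * 2 ^ (3 * n / 4) := by exact_mod_cast hB
  have hu' : (2 : ℝ) ^ (n - 1) ≤ n * u + B := by exact_mod_cast hu
  generalize (2 : ℝ) ^ ((-(1 / 4 : ℝ) + ε) * n) = q at *
  generalize (2 : ℝ) ^ ((1 / 4 : ℝ) * n) = Y at *
  generalize (2 : ℝ) ^ ((3 / 4 : ℝ) * n) = W at *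
  generalize (2 : ℝ) ^ (n - 1) = X at *
  have hBW : (B : ℝ) ≤ 2 * n ^ 2 * W :=
    hB'.trans (mul_le_mul_of_nonneg_left hfloor (by positivity))
  have h1 : 8 * (n : ℝ) ^ 2 * W ≤ 2 * X := hYW ▸ mul_le_mul_of_nonneg_right hn2 hWpos.le
  have h2 : Y * W ≤ 4 * (n * u) := by linarith
  have h3 : 8 * (n : ℝ) ^ 3 * W ≤ 4 * (n * (q * u)) := by
    calc 8 * (n : ℝ) ^ 3 * W ≤ q * Y * W :=
          mul_le_mul_of_nonneg_right (hn3.trans hqY.ge) hWpos.le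
      _ = q * (Y * W) := by ring
      _ ≤ q * (4 * (n * u)) := mul_le_mul_of_nonneg_left h2 hqpos.le
      _ = 4 * (n * (q * u)) := by ring
  have h4 : (n : ℝ) * B ≤ n * (q * u) := by
    have := mul_le_mul_of_nonneg_left hBW hn0.le
    nlinarith
  exact div_le_of_le_mul₀ (by positivity) hqpos.le (le_of_mul_le_mul_left h4 hn0)

/-- Transition from random unlabeled to random labeled circulant digraphs:
for every `ε > 0` and all sufficiently large `n`, if `R` is an isomorphism-invariant
family of connection sets, then the fraction of labeled circulant digraphs lying in
`R` is at least the fraction of isomorphism classes lying in `R` minus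
`2^{(-1/4+ε)n}`. -/
theorem stmt15 :
    ∀ ε : ℝ, 0 < ε → ∃ N : ℕ, ∀ n : ℕ, N ≤ n →
      ∀ R : Set (Finset (ZMod n)),
        (∀ S ∈ R, (0 : ZMod n) ∉ S) →
        (∀ S ∈ R, ∀ T : Finset (ZMod n), (0 : ZMod n) ∉ T → CayIso n S T → T ∈ R) →
        ({E : Set (Fin n × Fin n) | ∃ T ∈ R, IsLabeledCopy n E T}.ncard : ℝ) /
            ({E : Set (Fin n × Fin n) |
              ∃ T : Finset (ZMod n), (0 : ZMod n) ∉ T ∧ IsLabeledCopy n E T}.ncard) ≥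
          (numIsoClasses n R : ℝ) /
              (numIsoClasses n {S : Finset (ZMod n) | (0 : ZMod n) ∉ S}) -
            (2 : ℝ) ^ ((-(1 / 4 : ℝ) + ε) * n) := by

  intro ε hε
  obtain ⟨N, hN⟩ := exists_threshold hε
  refine ⟨N, fun n hn R hR0 _ => ?_⟩
  obtain ⟨hn1, hn3, hn2⟩ := hN n hn
  have : NeZero n := ⟨by omega⟩
  have hr := factorial_mul_numIsoClasses_le n R
  have hL := ncard_labeled_le n {S : Finset (ZMod n) | (0 : ZMod n) ∉ S}
  have hu := two_pow_le_mul_numIsoClasses_add n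
  have hB := ncard_cayAut_ne_translations_le n
  have hlL : {E : Set (Fin n × Fin n) | ∃ T ∈ R, IsLabeledCopy n E T}.ncard ≤
      {E : Set (Fin n × Fin n) | ∃ T : Finset (ZMod n), (0 : ZMod n) ∉ T ∧
        IsLabeledCopy n E T}.ncard :=
    Set.ncard_le_ncard fun E ⟨T, hT, hE⟩ => ⟨T, hR0 T hT, hE⟩
  simp only [Set.mem_ofPred_eq] at hL
  generalize {S : Finset (ZMod n) | cayAut n S ≠ translations n}.ncard = B at *
  generalize numIsoClasses n {S : Finset (ZMod n) | (0 : ZMod n) ∉ S} = u at *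
  generalize numIsoClasses n R = r at *
  generalize {E : Set (Fin n × Fin n) | ∃ T ∈ R, IsLabeledCopy n E T}.ncard = l at *
  generalize {E : Set (Fin n × Fin n) | ∃ T : Finset (ZMod n), (0 : ZMod n) ∉ T ∧
    IsLabeledCopy n E T}.ncard = L at *
  have hfpos : 0 < (n - 1).factorial := Nat.factorial_pos _
  generalize (n - 1).factorial = f at *
  have hBu := div_le_two_rpow hn1 hn3 hn2 hB hu
  have hq : (B : ℝ) / u + (r - B) / u = r / u := by rw [← add_div]; ring_nf
  suffices h : ((r : ℝ) - B) / u ≤ l / L by linarith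
  rcases le_or_gt r B with hrB | hrB
  · have h1 : (r : ℝ) ≤ B := by exact_mod_cast hrB
    exact (div_nonpos_of_nonpos_of_nonneg (by linarith) (by positivity)).trans (by positivity)
  · have hlpos : 0 < l := by
      have := Nat.mul_lt_mul_of_pos_left hrB hfpos
      omega
    have hLpos : 0 < L := hlpos.trans_le hlL
    have hupos : 0 < u := by
      rcases Nat.eq_zero_or_pos u with rfl | h
      · omega
      · exact h
    rw [div_le_div_iff₀ (by exact_mod_cast hupos) (by exact_mod_cast hLpos)]
    have hr' : (f : ℝ) * r ≤ l + f * B := by exact_mod_cast hr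
    have hL' : (L : ℝ) ≤ f * u := by exact_mod_cast hL
    have hrB' : (B : ℝ) < r := by exact_mod_cast hrB
    calc ((r : ℝ) - B) * L ≤ (r - B) * (f * u) :=
          mul_le_mul_of_nonneg_left hL' (by linarith)
      _ = (f * r - f * B) * u := by ring
      _ ≤ l * u := mul_le_mul_of_nonneg_right (by linarith) (by positivity)
end

section
/- For every ε > 0 there exists N such that for all n ≥ N: the number of inverse-closed subsets S ⊆ Z_n \ {0} (i.e., with S = −S) such that the circulant graph Cay(Z_n,S) is compact is at least (1 − n^{−1/2+ε})·2^{⌊n/2⌋}. That is, a uniformly random circulant graph on n vertices is compact with probability at least 1 − n^{−1/2+ε}. -/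
/-- The real adjacency matrix of the circulant (di)graph `Cay(Z_n, S)`. -/
noncomputable def cayAdjR (n : ℕ) (S : Finset (ZMod n)) : Matrix (ZMod n) (ZMod n) ℝ :=
  fun x y => if y - x ∈ S then 1 else 0

/-- The polytope of fractional automorphisms of `Cay(Z_n, S)`: doubly stochastic
matrices `D` commuting with the adjacency matrix `A` (sums written as `tsum`, which
agrees with the finite sums since `Z_n` is finite for `n > 0`). -/
noncomputable def fracAuts (n : ℕ) (S : Finset (ZMod n)) :
    Set (Matrix (ZMod n) (ZMod n) ℝ) :=
  {D | (∀ i j, 0 ≤ D i j) ∧ (∀ i, ∑' j, D i j = 1) ∧ (∀ j, ∑' i, D i j = 1) ∧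
    ∀ x y, ∑' w, cayAdjR n S x w * D w y = ∑' w, D x w * cayAdjR n S w y}

/-- The graph `Cay(Z_n, S)` is compact in the sense of Tinhofer: every extreme point
of its polytope of fractional automorphisms is a 0-1 (i.e. permutation) matrix. -/
def IsTinhoferCompact (n : ℕ) (S : Finset (ZMod n)) : Prop :=
  ∀ D ∈ (fracAuts n S).extremePoints ℝ, ∀ i j, D i j = 0 ∨ D i j = 1

open Finset

section Compactness

variable {n : ℕ} [NeZero n]

/-- The eigenvalue of `Cay(Z_n, S)` at the character `x ↦ exp (2πi j x / n)`. -/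
noncomputable def circulantEigenvalue (S : Finset (ZMod n)) (j : ZMod n) : ℂ :=
  ∑ s ∈ S, ZMod.stdAddChar (j * s)

theorem mem_fracAuts_iff {S : Finset (ZMod n)} {D : Matrix (ZMod n) (ZMod n) ℝ} :
    D ∈ fracAuts n S ↔ (∀ i j, 0 ≤ D i j) ∧ (∀ i, ∑ j, D i j = 1) ∧ (∀ j, ∑ i, D i j = 1) ∧
      cayAdjR n S * D = D * cayAdjR n S := by
  simp only [fracAuts, tsum_fintype, Set.mem_ofPred_eq, ← Matrix.ext_iff, Matrix.mul_apply]

theorem convex_fracAuts (S : Finset (ZMod n)) : Convex ℝ (fracAuts n S) := by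
  intro D hD E hE a b ha hb hab
  rw [mem_fracAuts_iff] at *
  obtain ⟨hD0, hD1, hD2, hD3⟩ := hD
  obtain ⟨hE0, hE1, hE2, hE3⟩ := hE
  refine ⟨fun i j => ?_, fun i => ?_, fun j => ?_, ?_⟩
  · have := hD0 i j
    have := hE0 i j
    simp only [Matrix.add_apply, Matrix.smul_apply, smul_eq_mul]
    positivity
  · simp [sum_add_distrib, ← mul_sum, hD1, hE1, hab]
  · simp [sum_add_distrib, ← mul_sum, hD2, hE2, hab]
  · simp [mul_add, add_mul, hD3, hE3]

/-- The permutation matrix of a rotation of `Z_n`. -/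
def rotationMatrix (a : ZMod n) : Matrix (ZMod n) (ZMod n) ℝ :=
  fun x y => if x - y = a then 1 else 0

/-- The permutation matrix of a reflection of `Z_n`. -/
def reflectionMatrix (b : ZMod n) : Matrix (ZMod n) (ZMod n) ℝ :=
  fun x y => if x + y = b then 1 else 0

theorem rotationMatrix_mem_fracAuts (S : Finset (ZMod n)) (a : ZMod n) :
    rotationMatrix a ∈ fracAuts n S := by
  have h1 (x y : ZMod n) : x - y = a ↔ y = x - a := by grind
  have h2 (x y : ZMod n) : x - y = a ↔ x = a + y := by grind
  rw [mem_fracAuts_iff]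
  refine ⟨fun i j => ?_, fun i => ?_, fun j => ?_, ?_⟩
  · unfold rotationMatrix
    positivity
  · simp [rotationMatrix, h1]
  · simp [rotationMatrix, h2]
  · ext x y
    simp only [Matrix.mul_apply, rotationMatrix]
    conv_lhs => simp only [h2]
    conv_rhs => simp only [h1]
    simp only [mul_ite, mul_one, mul_zero, ite_mul, one_mul, zero_mul, sum_ite_eq', mem_univ,
      if_true]
    unfold cayAdjR
    congr 2
    ring

theorem reflectionMatrix_mem_fracAuts {S : Finset (ZMod n)} (hS : ∀ x, x ∈ S ↔ -x ∈ S)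
    (b : ZMod n) : reflectionMatrix b ∈ fracAuts n S := by
  have h1 (x y : ZMod n) : x + y = b ↔ y = b - x := by grind
  have h2 (x y : ZMod n) : x + y = b ↔ x = b - y := by grind
  rw [mem_fracAuts_iff]
  refine ⟨fun i j => ?_, fun i => ?_, fun j => ?_, ?_⟩
  · unfold reflectionMatrix
    positivity
  · simp [reflectionMatrix, h1]
  · simp [reflectionMatrix, h2]
  · ext x y
    simp only [Matrix.mul_apply, reflectionMatrix]
    conv_lhs => simp only [h2]
    conv_rhs => simp only [h1]
    simp only [mul_ite, mul_one, mul_zero, ite_mul, one_mul, zero_mul, sum_ite_eq', mem_univ,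
      if_true]
    unfold cayAdjR
    simp only [hS (b - y - x)]
    congr 2
    ring

theorem sum_stdAddChar_mul (b : ZMod n) :
    ∑ p : ZMod n, ZMod.stdAddChar (p * b) = if b = 0 then (n : ℂ) else 0 := by
  simpa using AddChar.sum_mulShift b (ZMod.isPrimitive_stdAddChar n)

/-- The two-dimensional Fourier transform of a matrix indexed by `Z_n`. -/
noncomputable def matrixFourier (D : Matrix (ZMod n) (ZMod n) ℝ) (p q : ZMod n) : ℂ :=
  ∑ x, ∑ y, ZMod.stdAddChar (-(p * x)) * D x y * ZMod.stdAddChar (q * y)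

theorem matrixFourier_inversion (D : Matrix (ZMod n) (ZMod n) ℝ) (x y : ZMod n) :
    (D x y : ℂ) = (∑ q, ∑ p, matrixFourier D p q * ZMod.stdAddChar (p * x - q * y)) / n ^ 2 := by
  have hn : (n : ℂ) ≠ 0 := by exact_mod_cast NeZero.ne n
  rw [eq_div_iff (by positivity)]
  have key (q p : ZMod n) : matrixFourier D p q * ZMod.stdAddChar (p * x - q * y) =
      ∑ x', ∑ y', (D x' y' : ℂ) *
        (ZMod.stdAddChar (p * (x - x')) * ZMod.stdAddChar (q * (y' - y))) := by
    simp only [matrixFourier, sum_mul]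
    refine sum_congr rfl fun x' _ => sum_congr rfl fun y' _ => ?_
    rw [mul_right_comm, mul_right_comm (ZMod.stdAddChar _), mul_comm _ (D x' y' : ℂ), mul_assoc]
    simp only [← AddChar.map_add_eq_mul]
    congr 2
    ring
  simp only [key]
  have h1 (q : ZMod n) : ∑ p, ∑ x', ∑ y', (D x' y' : ℂ) *
        (ZMod.stdAddChar (p * (x - x')) * ZMod.stdAddChar (q * (y' - y))) =
        ∑ y', n * (D x y' : ℂ) * ZMod.stdAddChar (q * (y' - y)) := by
    rw [sum_comm]
    rw [sum_eq_single x]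
    · rw [sum_comm]
      simp [mul_assoc]
    · intro x' _ hx
      rw [sum_comm]
      refine sum_eq_zero fun y' _ => ?_
      rw [← mul_sum, ← sum_mul, sum_stdAddChar_mul, if_neg (by grind)]
      simp
    · simp
  simp only [h1]
  rw [sum_comm]
  simp only [← mul_sum, sum_stdAddChar_mul, sub_eq_zero]
  simp
  ring

theorem eigenvalue_mul_matrixFourier {S : Finset (ZMod n)} {D : Matrix (ZMod n) (ZMod n) ℝ}
    (hD : cayAdjR n S * D = D * cayAdjR n S) (p q : ZMod n) :
    circulantEigenvalue S p * matrixFourier D p q =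
      circulantEigenvalue S q * matrixFourier D p q := by
  have hl (w : ZMod n) : ∑ x, ZMod.stdAddChar (-(p * x)) * (cayAdjR n S x w : ℂ) =
      circulantEigenvalue S p * ZMod.stdAddChar (-(p * w)) := by
    rw [← Equiv.sum_comp (Equiv.subLeft w)]
    simp only [Equiv.subLeft_apply, cayAdjR, sub_sub_cancel, apply_ite Complex.ofReal,
      Complex.ofReal_one, Complex.ofReal_zero, mul_ite, mul_one, mul_zero, sum_ite_mem,
      univ_inter, circulantEigenvalue, sum_mul, ← AddChar.map_add_eq_mul]
    refine sum_congr rfl fun s _ => congrArg _ (by ring)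
  have hr (w : ZMod n) : ∑ y, (cayAdjR n S w y : ℂ) * ZMod.stdAddChar (q * y) =
      circulantEigenvalue S q * ZMod.stdAddChar (q * w) := by
    rw [← Equiv.sum_comp (Equiv.addRight w)]
    simp only [Equiv.coe_addRight, cayAdjR, add_sub_cancel_right, apply_ite Complex.ofReal,
      Complex.ofReal_one, Complex.ofReal_zero, ite_mul, one_mul, zero_mul, sum_ite_mem,
      univ_inter, circulantEigenvalue, sum_mul, ← AddChar.map_add_eq_mul, mul_add]
  have h (x y : ZMod n) : ∑ w, (cayAdjR n S x w : ℂ) * D w y =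
      ∑ w, (D x w : ℂ) * cayAdjR n S w y := by
    have := congrFun (congrFun hD x) y
    simp only [Matrix.mul_apply] at this
    exact_mod_cast this
  calc circulantEigenvalue S p * matrixFourier D p q
      = ∑ w, ∑ y, (circulantEigenvalue S p * ZMod.stdAddChar (-(p * w))) * D w y *
          ZMod.stdAddChar (q * y) := by
        simp only [matrixFourier, mul_sum, mul_assoc]
    _ = ∑ x, ∑ y, ZMod.stdAddChar (-(p * x)) * (∑ w, (cayAdjR n S x w : ℂ) * D w y) *
          ZMod.stdAddChar (q * y) := by
        simp only [← hl, sum_mul, mul_sum]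
        refine (sum_congr rfl fun w _ => sum_comm).trans (sum_comm.trans ?_)
        refine sum_congr rfl fun x _ => sum_comm.trans ?_
        simp only [mul_assoc]
    _ = ∑ x, ∑ w, ZMod.stdAddChar (-(p * x)) * D x w *
          (∑ y, (cayAdjR n S w y : ℂ) * ZMod.stdAddChar (q * y)) := by
        simp only [h, sum_mul, mul_sum]
        refine sum_congr rfl fun x _ => ?_
        rw [sum_comm]
        simp only [mul_assoc]
    _ = _ := by
        simp only [hr, matrixFourier, mul_sum]
        refine sum_congr rfl fun x _ => sum_congr rfl fun w _ => by ring

theorem exists_eq_add_of_separated {S : Finset (ZMod n)}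
    (hsep : ∀ j k, circulantEigenvalue S j = circulantEigenvalue S k → j = k ∨ j = -k)
    {D : Matrix (ZMod n) (ZMod n) ℝ} (hD : cayAdjR n S * D = D * cayAdjR n S) :
    ∃ f g : ZMod n → ℝ, ∀ x y, D x y = f (x - y) + g (x + y) := by
  have h0 (p q : ZMod n) (h1 : p ≠ q) (h2 : p ≠ -q) : matrixFourier D p q = 0 := by
    by_contra h
    rcases hsep p q (mul_right_cancel₀ h (eigenvalue_mul_matrixFourier hD p q)) with h | h
    exacts [h1 h, h2 h]
  refine ⟨fun a => ((∑ q, matrixFourier D q q * ZMod.stdAddChar (q * a)) / n ^ 2 : ℂ).re,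
    fun b => ((∑ q, if -q = q then 0 else
      matrixFourier D (-q) q * ZMod.stdAddChar (-q * b)) / n ^ 2 : ℂ).re, fun x y => ?_⟩
  rw [← Complex.add_re, ← add_div, ← sum_add_distrib, ← Complex.ofReal_re (D x y),
    matrixFourier_inversion]
  congr 2
  refine sum_congr rfl fun q _ => ?_
  by_cases hq : -q = q
  · rw [sum_eq_single q (fun p _ hp => by rw [h0 p q hp (by rwa [hq]), zero_mul]) (by simp)]
    simp [hq, mul_sub]
  · rw [← sum_subset (subset_univ {q, -q}) (fun p _ hp => by
      simp only [mem_insert, mem_singleton, not_or] at hp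
      rw [h0 p q hp.1 hp.2, zero_mul]), sum_pair (Ne.symm hq), if_neg hq]
    congr 3 <;> ring

theorem exists_nonneg_eq_add {D : Matrix (ZMod n) (ZMod n) ℝ} (hD : ∀ i j, 0 ≤ D i j)
    (h : ∃ f g : ZMod n → ℝ, ∀ x y, D x y = f (x - y) + g (x + y)) :
    ∃ f g : ZMod n → ℝ, (∀ a, 0 ≤ f a) ∧ (∀ b, 0 ≤ g b) ∧
      ∀ x y, D x y = f (x - y) + g (x + y) := by
  obtain ⟨f, g, hfg⟩ := h
  let μ (a : ZMod n) : ℝ := univ.inf' univ_nonempty fun z : ZMod n => f (a + 2 * z)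
  have hle (a w : ZMod n) : μ (a + 2 * w) ≤ μ a := by
    refine le_inf' _ _ fun z _ => ?_
    refine (inf'_le _ (mem_univ (z - w))).trans_eq (congrArg f (by ring))
  refine ⟨fun a => f a - μ a, fun b => g b + μ b, fun a => ?_, fun b => ?_, fun x y => ?_⟩
  · rw [sub_nonneg]
    exact (inf'_le _ (mem_univ 0)).trans_eq (by simp)
  · obtain ⟨z, -, hz⟩ := exists_mem_eq_inf' univ_nonempty fun z : ZMod n => f (b + 2 * z)
    have := hD (b + z) (-z)
    rw [hfg] at this
    have e1 : b + z - -z = b + 2 * z := by ring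
    have e2 : b + z + -z = b := by ring
    rw [e1, e2] at this
    change 0 ≤ g b + univ.inf' univ_nonempty _
    rw [hz]
    linarith
  · have e1 := hle (x - y) y
    have e2 := hle (x + y) (-y)
    have e3 : x - y + 2 * y = x + y := by ring
    have e4 : x + y + 2 * -y = x - y := by ring
    rw [e3] at e1
    rw [e4] at e2
    rw [hfg]
    linarith

/-- If the only coincidences among the eigenvalues are the forced ones `λ_j = λ_{-j}`, then the
circulant graph has the same fractional automorphisms as the cycle, and is compact. -/
theorem isTinhoferCompact_of_separated {S : Finset (ZMod n)} (hS : ∀ x, x ∈ S ↔ -x ∈ S)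
    (hsep : ∀ j k, circulantEigenvalue S j = circulantEigenvalue S k → j = k ∨ j = -k) :
    IsTinhoferCompact n S := by
  intro D hD
  have hmem := hD.1
  rw [mem_fracAuts_iff] at hmem
  obtain ⟨h0, h1, -, h3⟩ := hmem
  obtain ⟨f, g, hf, hg, hfg⟩ := exists_nonneg_eq_add h0 (exists_eq_add_of_separated hsep h3)
  let M : ZMod n ⊕ ZMod n → Matrix (ZMod n) (ZMod n) ℝ := Sum.elim rotationMatrix reflectionMatrix
  have hsub : convexHull ℝ (Set.range M) ⊆ fracAuts n S := by
    refine convexHull_min ?_ (convex_fracAuts S)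
    rintro _ ⟨a | b, rfl⟩
    exacts [rotationMatrix_mem_fracAuts S a, reflectionMatrix_mem_fracAuts hS b]
  have hDM : D = ∑ i, (Sum.elim f g i) • M i := by
    ext x y
    simp [M, Matrix.sum_apply, rotationMatrix, reflectionMatrix, hfg]
  have hsum : ∑ i, Sum.elim f g i = 1 := by
    have := h1 0
    simp only [hfg, zero_sub, zero_add, sum_add_distrib] at this
    rw [← this, Fintype.sum_sum_type]
    congr 1
    exact (Equiv.sum_comp (Equiv.neg (ZMod n)) f).symm
  have hhull : D ∈ convexHull ℝ (Set.range M) := by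
    rw [hDM]
    refine (convex_convexHull ℝ _).sum_mem ?_ hsum
      fun i _ => subset_convexHull ℝ _ (Set.mem_range_self i)
    rintro (a | b) -
    exacts [hf a, hg b]
  obtain ⟨a | b, rfl⟩ := extremePoints_convexHull_subset
    (inter_extremePoints_subset_extremePoints_of_subset hsub ⟨hhull, hD⟩)
  · intro i j
    simp only [M, Sum.elim_inl, rotationMatrix]
    split_ifs <;> simp
  · intro i j
    simp only [M, Sum.elim_inr, reflectionMatrix]
    split_ifs <;> simp

end Compactness

section Counting

theorem two_mul_add_one_mul_centralBinom_sq_le (k : ℕ) :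
    (2 * k + 1) * k.centralBinom ^ 2 ≤ 16 ^ k := by
  induction k with
  | zero => simp
  | succ k ih =>
    have h := Nat.succ_mul_centralBinom_succ k
    refine Nat.le_of_mul_le_mul_left ?_ (show 0 < (k + 1) ^ 2 by positivity)
    calc (k + 1) ^ 2 * ((2 * (k + 1) + 1) * (k + 1).centralBinom ^ 2)
        = (2 * k + 3) * ((k + 1) * (k + 1).centralBinom) ^ 2 := by ring
      _ = 4 * ((2 * k + 3) * (2 * k + 1)) * ((2 * k + 1) * k.centralBinom ^ 2) := by
        rw [h]; ring
      _ ≤ 4 * (4 * (k + 1) ^ 2) * 16 ^ k := by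
        exact Nat.mul_le_mul (by nlinarith) ih
      _ = (k + 1) ^ 2 * 16 ^ (k + 1) := by ring

/-- A Littlewood–Offord bound for sums having many equal nonzero weights. -/
theorem card_filter_sum_eq_zero_le {ι : Type*} [DecidableEq ι] {I J : Finset ι} (hJI : J ⊆ I)
    {w : ι → ℂ} {d : ℂ} (hd : d ≠ 0) (hw : ∀ i ∈ J, w i = d) (B : Finset (Finset ι))
    (hB : ∀ T ∈ B, T ⊆ I ∧ ∑ i ∈ T, w i = 0) :
    #B ≤ (#J).choose (#J / 2) * 2 ^ (#I - #J) := by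
  have himg : B.image (· \ J) ⊆ (I \ J).powerset := by
    intro U hU
    obtain ⟨T, hT, rfl⟩ := mem_image.1 hU
    exact mem_powerset.2 (sdiff_subset_sdiff (hB T hT).1 le_rfl)
  refine (card_le_mul_card_image B _ fun U hU => ?_).trans
    (Nat.mul_le_mul_left _ ((card_le_card himg).trans_eq ?_))
  · obtain ⟨T₀, hT₀, rfl⟩ := mem_image.1 hU
    have hsum (T : Finset ι) : ∑ i ∈ T, w i = #(T ∩ J) * d + ∑ i ∈ T \ J, w i := by
      rw [← sum_inter_add_sum_sdiff T J, sum_congr rfl fun i hi => hw i (mem_inter.1 hi).2]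
      simp
    refine le_trans ?_ (Nat.choose_le_middle (#(T₀ ∩ J)) (#J))
    rw [← card_powersetCard]
    refine card_le_card_of_injOn (· ∩ J) (fun T hT => ?_) fun T hT T' hT' h => ?_
    · obtain ⟨hTB, hT⟩ := mem_filter.1 (mem_coe.1 hT)
      refine mem_coe.2 (mem_powersetCard.2 ⟨inter_subset_right, ?_⟩)
      have h1 := (hB T hTB).2
      have h2 := (hB T₀ hT₀).2
      rw [hsum] at h1 h2
      rw [hT, ← h2] at h1
      exact_mod_cast mul_right_cancel₀ hd (add_right_cancel h1)
    · have h1 := (mem_filter.1 (mem_coe.1 hT)).2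
      have h2 := (mem_filter.1 (mem_coe.1 hT')).2
      rw [← sdiff_union_inter T J, ← sdiff_union_inter T' J, h1, h2]
      exact congrArg _ h
  · rw [card_powerset, card_sdiff_of_subset hJI]

theorem le_gcd_two_mul_totient_sq (n : ℕ) : n ≤ n.gcd 2 * n.totient ^ 2 := by
  induction n using Nat.recOnPosPrimePosCoprime with
  | prime_pow p k hp hk =>
    obtain ⟨m, rfl⟩ : ∃ m, k = m + 1 := ⟨k - 1, by omega⟩
    rw [Nat.totient_prime_pow_succ hp]
    rcases hp.eq_two_or_odd' with rfl | hodd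
    · have : (2 ^ (m + 1)).gcd 2 = 2 := Nat.gcd_eq_right (dvd_pow_self 2 (by omega))
      rw [this, pow_succ']
      have : 1 ≤ 2 ^ m := Nat.one_le_two_pow
      nlinarith
    · have h1 : 1 ≤ (p ^ (m + 1)).gcd 2 := Nat.gcd_pos_of_pos_right _ two_pos
      have h3 : 3 ≤ p := by
        have := hp.two_le
        rcases hodd with ⟨c, rfl⟩
        omega
      obtain ⟨q, rfl⟩ : ∃ q, p = q + 1 := ⟨p - 1, by omega⟩
      have hq : q + 1 ≤ q ^ 2 := by nlinarith
      have hm : (q + 1) ^ m ≤ ((q + 1) ^ m) ^ 2 := Nat.le_self_pow two_ne_zero _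
      calc (q + 1) ^ (m + 1) = 1 * ((q + 1) ^ m * (q + 1)) := by ring
        _ ≤ _ := Nat.mul_le_mul h1 (by
          rw [Nat.add_sub_cancel, mul_pow]
          exact Nat.mul_le_mul hm hq)
  | zero => simp
  | one => simp
  | coprime a b _ _ hab iha ihb =>
    rw [Nat.totient_mul hab, Nat.gcd_comm, hab.gcd_mul, Nat.gcd_comm 2, Nat.gcd_comm 2]
    calc a * b ≤ (a.gcd 2 * a.totient ^ 2) * (b.gcd 2 * b.totient ^ 2) := by gcongr
      _ = _ := by ring

theorem le_two_mul_totient_sq (n : ℕ) : n ≤ 2 * n.totient ^ 2 :=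
  (le_gcd_two_mul_totient_sq n).trans
    (Nat.mul_le_mul_right _ (Nat.le_of_dvd two_pos (Nat.gcd_dvd_right n 2)))

/-- A `d`-dimensional space of functions contains at most `2 ^ d` functions valued in `{0, 1}`. -/
theorem card_zero_one_vectors_le {ι K : Type*} [Fintype ι] [Field K] (V : Submodule K (ι → K))
    (F : Finset (ι → K)) (hV : ∀ x ∈ F, x ∈ V) (h01 : ∀ x ∈ F, ∀ i, x i = 0 ∨ x i = 1) :
    #F ≤ 2 ^ Module.finrank K V := by
  classical
  let π (i : ι) : Module.Dual K V := (LinearMap.proj i).comp V.subtype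
  obtain ⟨f, hf, hspan, -⟩ := Submodule.exists_fun_fin_finrank_span_eq K (Set.range π)
  choose c hc using hf
  have hle : Module.finrank K (Submodule.span K (Set.range π)) ≤ Module.finrank K V :=
    (Submodule.finrank_le _).trans_eq Subspace.dual_finrank_eq
  refine le_trans ?_ (Nat.pow_le_pow_right two_pos hle)
  have hcard := Fintype.card_fun (α := Fin (Module.finrank K (Submodule.span K (Set.range π))))
    (β := Bool)
  rw [Fintype.card_bool, Fintype.card_fin] at hcard
  rw [← hcard, ← card_univ]
  refine card_le_card_of_injOn (fun x i => decide (x (c i) = 1)) (by simp) fun x hx y hy hxy => ?_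
  let v : V := ⟨x, hV x hx⟩ - ⟨y, hV y hy⟩
  have hker : Submodule.span K (Set.range π) ≤ LinearMap.ker (Module.Dual.eval K V v) := by
    rw [← hspan, Submodule.span_le]
    rintro _ ⟨i, rfl⟩
    have hi : (x (c i) = 1) ↔ (y (c i) = 1) := by simpa using congrFun hxy i
    have : x (c i) = y (c i) := by
      rcases h01 x hx (c i) with h | h <;> rcases h01 y hy (c i) with h' | h' <;> simp_all
    simp [← hc, π, v, this]
  ext i
  have := hker (Submodule.subset_span (Set.mem_range_self i))
  simpa [π, v, sub_eq_zero] using this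

theorem two_mul_card_quotient_le {α : Type*} [Fintype α] [DecidableEq α] (r : Setoid α)
    [DecidableRel r.r] (O Z : Finset α)
    (h2 : ∀ p ∉ Z, ∃ q, r p q ∧ p ≠ q)
    (h3 : ∀ p ∈ O, ∃ q q', r p q ∧ r p q' ∧ p ≠ q ∧ p ≠ q' ∧ q ≠ q') :
    6 * Fintype.card (Quotient r) + #O ≤ 3 * Fintype.card α + 3 * #Z := by
  let w (c : Quotient r) : ℕ := #{q | Quotient.mk r q = c}
  have hsum : ∑ p, (1 : ℚ) / w (Quotient.mk r p) = Fintype.card (Quotient r) := by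
    rw [← sum_fiberwise univ (Quotient.mk r)]
    rw [← card_univ, card_eq_sum_ones, Nat.cast_sum]
    refine sum_congr rfl fun c _ => ?_
    rw [sum_congr rfl (g := fun _ => (1 : ℚ) / w c) fun p hp => by rw [(mem_filter.1 hp).2]]
    obtain ⟨p, rfl⟩ := Quotient.exists_rep c
    have : 0 < w (Quotient.mk r p) := card_pos.2 ⟨p, by simp⟩
    rw [sum_const, nsmul_eq_mul]
    change (w _ : ℚ) * _ = _
    field_simp
    simp
  have hw1 (p : α) : 1 ≤ w (Quotient.mk r p) := card_pos.2 ⟨p, by simp⟩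
  have hw2 (p : α) (hp : p ∉ Z) : 2 ≤ w (Quotient.mk r p) := by
    obtain ⟨q, hq, hne⟩ := h2 p hp
    rw [← card_pair hne]
    refine card_le_card fun x hx => ?_
    simp only [mem_insert, mem_singleton] at hx
    rw [mem_filter, Quotient.eq]
    rcases hx with rfl | rfl
    exacts [⟨mem_univ _, r.refl _⟩, ⟨mem_univ _, r.symm hq⟩]
  have hw3 (p : α) (hp : p ∈ O) : 3 ≤ w (Quotient.mk r p) := by
    obtain ⟨q, q', hq, hq', h1, h2, h3⟩ := h3 p hp
    rw [← card_eq_three.2 ⟨p, q, q', h1, h2, h3, rfl⟩]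
    refine card_le_card fun x hx => ?_
    simp only [mem_insert, mem_singleton] at hx
    rw [mem_filter, Quotient.eq]
    rcases hx with rfl | rfl | rfl
    exacts [⟨mem_univ _, r.refl _⟩, ⟨mem_univ _, r.symm hq⟩, ⟨mem_univ _, r.symm hq'⟩]
  have hle (p : α) : (1 : ℚ) / w (Quotient.mk r p) ≤
      1 / 2 - (if p ∈ O then 1 / 6 else 0) + (if p ∈ Z then 1 / 2 else 0) := by
    have hb (k : ℕ) (hk : 0 < k) (h : k ≤ w (Quotient.mk r p)) :
        (1 : ℚ) / w (Quotient.mk r p) ≤ 1 / k :=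
      one_div_le_one_div_of_le (by exact_mod_cast hk) (by exact_mod_cast h)
    have b1 := hb 1 one_pos (hw1 p)
    by_cases hO : p ∈ O
    · have b3 := hb 3 three_pos (hw3 p hO)
      push_cast at b3
      rw [if_pos hO]
      split_ifs <;> linarith
    · rw [if_neg hO]
      by_cases hZ : p ∈ Z
      · rw [if_pos hZ]
        push_cast at b1
        linarith
      · have b2 := hb 2 two_pos (hw2 p hZ)
        push_cast at b2
        rw [if_neg hZ]
        linarith
  have := sum_le_sum fun p (_ : p ∈ (univ : Finset α)) => hle p
  rw [hsum, sum_add_distrib, sum_sub_distrib] at this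
  simp only [sum_ite_mem, univ_inter, sum_const, card_univ, nsmul_eq_mul] at this
  have h6 : (6 * Fintype.card (Quotient r) + #O : ℚ) ≤ 3 * Fintype.card α + 3 * #Z := by linarith
  exact_mod_cast h6

theorem neg_ne_self_of_two_lt_addOrderOf {n : ℕ} {j : ZMod n}
    (h : 2 < addOrderOf j) : j ≠ -j := by
  intro hj
  refine absurd (addOrderOf_le_of_nsmul_eq_zero two_pos ?_) h.not_ge
  rw [two_nsmul]
  nth_rw 2 [hj]
  exact add_neg_cancel j

variable {n : ℕ} [NeZero n]

theorem circulantEigenvalue_neg {S : Finset (ZMod n)} (hS : ∀ x, x ∈ S ↔ -x ∈ S) (j : ZMod n) :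
    circulantEigenvalue S (-j) = circulantEigenvalue S j :=
  sum_nbij' (- ·) (- ·) (fun x hx => (hS x).1 hx) (fun x hx => (hS x).1 hx)
    (by simp) (by simp) (by simp)

/-- Galois conjugation of coincidences between eigenvalues. -/
theorem circulantEigenvalue_units_mul {S : Finset (ZMod n)} {j k : ZMod n}
    (h : circulantEigenvalue S j = circulantEigenvalue S k) (u : (ZMod n)ˣ) :
    circulantEigenvalue S (u * j) = circulantEigenvalue S (u * k) := by
  have hn : n ≠ 0 := NeZero.ne n
  set ζ : ℂ := Complex.exp (2 * Real.pi * Complex.I / n) with hζ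
  have hprim : IsPrimitiveRoot ζ n := Complex.isPrimitiveRoot_exp n hn
  have hchar (m : ℕ) : ZMod.stdAddChar (m : ZMod n) = ζ ^ m := by
    have := ZMod.stdAddChar_coe (N := n) m
    rw [Int.cast_natCast] at this
    rw [this, hζ, ← Complex.exp_nat_mul]
    congr 1
    push_cast
    ring
  let P : Polynomial ℤ := ∑ s ∈ S, (Polynomial.X ^ (j * s).val - Polynomial.X ^ (k * s).val)
  have hP (m : ℕ) : Polynomial.aeval (ζ ^ m) P =
      circulantEigenvalue S ((m : ZMod n) * j) - circulantEigenvalue S (m * k) := by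
    have (i s : ZMod n) : (ζ ^ m) ^ (i * s).val = ZMod.stdAddChar ((m : ZMod n) * i * s) := by
      rw [← pow_mul, ← hchar]
      simp [mul_assoc]
    simp [P, circulantEigenvalue, this]
  have hdvd : Polynomial.cyclotomic n ℤ ∣ P := by
    rw [Polynomial.cyclotomic_eq_minpoly hprim (by omega)]
    refine minpoly.isIntegrallyClosed_dvd (hprim.isIntegral (by omega)) ?_
    have := hP 1
    rw [pow_one] at this
    rw [this]
    simp [h]
  obtain ⟨Q, hQ⟩ := hdvd
  have hu := hP (u : ZMod n).val
  have hroot : Polynomial.aeval (ζ ^ (u : ZMod n).val) (Polynomial.cyclotomic n ℤ) = 0 := by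
    have hp := hprim.pow_of_coprime _ (ZMod.val_coe_unit_coprime u)
    rw [Polynomial.cyclotomic_eq_minpoly hp (by omega)]
    exact minpoly.aeval _ _
  rw [hQ, map_mul, hroot, zero_mul] at hu
  simpa [sub_eq_zero] using hu.symm

theorem card_le_two_pow_card_quotient (r : Setoid (ZMod n)) [DecidableRel r.r]
    (B : Finset (Finset (ZMod n)))
    (hB : ∀ S ∈ B, ∀ p q, r p q → circulantEigenvalue S p = circulantEigenvalue S q) :
    #B ≤ 2 ^ Fintype.card (Quotient r) := by
  let V : Submodule ℂ (ZMod n → ℂ) :=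
    { carrier := {x | ∀ p q, r p q → ZMod.dft x (-p) = ZMod.dft x (-q)}
      add_mem' := fun hx hy p q h => by simp [hx p q h, hy p q h]
      zero_mem' := fun p q h => by simp
      smul_mem' := fun c x hx p q h => by simp [hx p q h] }
  let ρ : V →ₗ[ℂ] (Quotient r → ℂ) :=
    { toFun := fun x => Quotient.lift (fun p => ZMod.dft x.1 (-p)) x.2
      map_add' := fun x y => by
        ext c
        induction c using Quotient.inductionOn
        simp
      map_smul' := fun c x => by
        ext c
        induction c using Quotient.inductionOn
        simp }
  have hρ : Function.Injective ρ := by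
    intro x y h
    refine Subtype.ext (ZMod.dft.injective (funext fun p => ?_))
    simpa [ρ] using congrFun h (Quotient.mk r (-p))
  have hfin : Module.finrank ℂ V ≤ Fintype.card (Quotient r) :=
    (LinearMap.finrank_le_finrank_of_injective hρ).trans_eq (Module.finrank_fintype_fun_eq_card ℂ)
  let ind (S : Finset (ZMod n)) : ZMod n → ℂ := fun s => if s ∈ S then 1 else 0
  have hind : Function.Injective ind := fun S S' h => by
    ext s
    have := congrFun h s
    by_cases h1 : s ∈ S <;> by_cases h2 : s ∈ S' <;> simp_all [ind]
  have hdft (S : Finset (ZMod n)) (p : ZMod n) :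
      ZMod.dft (ind S) (-p) = circulantEigenvalue S p := by
    simp [ZMod.dft_apply, ind, circulantEigenvalue, mul_comm]
  rw [← card_image_of_injective B hind]
  refine (card_zero_one_vectors_le V _ ?_ ?_).trans (Nat.pow_le_pow_right two_pos hfin)
  · intro x hx
    obtain ⟨S, hS, rfl⟩ := mem_image.1 hx
    intro p q hpq
    rw [hdft, hdft, hB S hS p q hpq]
  · intro x hx i
    obtain ⟨S, hS, rfl⟩ := mem_image.1 hx
    simp only [ind]
    split_ifs <;> simp

theorem totient_le_card_orbit (j : ZMod n) :
    (addOrderOf j).totient ≤ #{p : ZMod n | ∃ u : (ZMod n)ˣ, (u : ZMod n) * j = p} := by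
  have hd : addOrderOf j ∣ n := by simpa using addOrderOf_dvd_card (x := j)
  have : NeZero (addOrderOf j) := ⟨fun h => NeZero.ne n (Nat.eq_zero_of_zero_dvd (h ▸ hd))⟩
  choose f hf using ZMod.unitsMap_surjective hd
  rw [← ZMod.card_units_eq_totient, ← card_univ]
  refine card_le_card_of_injOn (fun v => (f v : ZMod n) * j) (by simp) fun v _ v' _ h => ?_
  have h0 : ((f v : ZMod n) - f v') * j = 0 := by
    rw [sub_mul, sub_eq_zero]
    exact h
  have h1 : ((((f v : ZMod n) - f v').val : ZMod (addOrderOf j))) = 0 := by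
    rw [ZMod.natCast_eq_zero_iff]
    refine addOrderOf_dvd_of_nsmul_eq_zero ?_
    rw [nsmul_eq_mul, ZMod.natCast_zmod_val, h0]
  rw [ZMod.natCast_val, ZMod.cast_sub hd, sub_eq_zero] at h1
  rw [← hf v, ← hf v']
  ext
  simpa [ZMod.unitsMap_val] using h1

theorem card_le_two_pow_of_large_order {j k : ZMod n} (hjk : j ≠ k) (hjk' : j ≠ -k)
    (hj : 2 < addOrderOf j) (B : Finset (Finset (ZMod n)))
    (hB : ∀ S ∈ B, (∀ x, x ∈ S ↔ -x ∈ S) ∧ circulantEigenvalue S j = circulantEigenvalue S k) :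
    #B * 2 ^ ((addOrderOf j).totient / 6) ≤ 2 ^ (n / 2 + 1) := by
  classical
  let r : Setoid (ZMod n) :=
    { r := fun p q => ∀ S ∈ B, circulantEigenvalue S p = circulantEigenvalue S q
      iseqv := ⟨fun _ _ _ => rfl, fun h S hS => (h S hS).symm,
        fun h h' S hS => (h S hS).trans (h' S hS)⟩ }
  have hneg (p : ZMod n) : r p (-p) := fun S hS => (circulantEigenvalue_neg (hB S hS).1 p).symm
  have hquot := two_mul_card_quotient_le r {p : ZMod n | ∃ u : (ZMod n)ˣ, (u : ZMod n) * j = p}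
    {p : ZMod n | -p = p} (fun p hp => ⟨-p, hneg p, fun h => hp (by simp [← h])⟩) ?_
  · have hZ : #{p : ZMod n | -p = p} ≤ 2 := by
      refine (card_le_card (t := {0, ((n / 2 : ℕ) : ZMod n)}) fun p hp => ?_).trans card_le_two
      rw [mem_filter, ZMod.neg_eq_self_iff] at hp
      rcases hp.2 with h | h
      · simp [h]
      · rw [mem_insert, mem_singleton]
        right
        rw [← ZMod.natCast_zmod_val p]
        congr 1
        omega
    have hO := totient_le_card_orbit j
    rw [ZMod.card] at hquot
    refine (Nat.mul_le_mul_right _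
      (card_le_two_pow_card_quotient r B fun S hS p q h => h S hS)).trans ?_
    rw [← pow_add]
    exact Nat.pow_le_pow_right two_pos (by omega)
  · intro p hp
    obtain ⟨u, rfl⟩ := (mem_filter.1 hp).2
    refine ⟨-(u * j), u * k, hneg _, fun S hS => circulantEigenvalue_units_mul (hB S hS).2 u,
      ?_, ?_, ?_⟩
    · rw [← mul_neg, u.isUnit.mul_right_injective.ne_iff]
      exact neg_ne_self_of_two_lt_addOrderOf hj
    · rwa [u.isUnit.mul_right_injective.ne_iff]
    · rw [← mul_neg, u.isUnit.mul_right_injective.ne_iff]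
      exact fun h => hjk' (by rw [← h, neg_neg])

/-- The inverse-closed subset of `Z_n` whose elements have absolute values in `T`. -/
def symmetricSet (n : ℕ) [NeZero n] (T : Finset ℕ) : Finset (ZMod n) :=
  {s | s.valMinAbs.natAbs ∈ T}

theorem mem_symmetricSet_iff_neg (T : Finset ℕ) (x : ZMod n) :
    x ∈ symmetricSet n T ↔ -x ∈ symmetricSet n T := by
  simp [symmetricSet, ZMod.natAbs_valMinAbs_neg]

theorem zero_notMem_symmetricSet {T : Finset ℕ} (hT : T ⊆ Icc 1 (n / 2)) :
    (0 : ZMod n) ∉ symmetricSet n T := by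
  intro h
  have := hT (mem_filter.1 h).2
  simp at this

theorem natCast_mem_symmetricSet {T : Finset ℕ} {t : ℕ} (ht : t ≤ n / 2) :
    (t : ZMod n) ∈ symmetricSet n T ↔ t ∈ T := by
  simp [symmetricSet, ZMod.valMinAbs_natCast_of_le_half ht]

theorem symmetricSet_injOn :
    Set.InjOn (symmetricSet n) ((Icc 1 (n / 2)).powerset : Set (Finset ℕ)) := by
  have key {T T' : Finset ℕ} (hT : T ⊆ Icc 1 (n / 2)) (h : symmetricSet n T = symmetricSet n T') :
      T ⊆ T' := fun t ht => by
    have hle := (mem_Icc.1 (hT ht)).2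
    rwa [← natCast_mem_symmetricSet hle, ← h, natCast_mem_symmetricSet hle]
  intro T hT T' hT' h
  exact (key (mem_powerset.1 (mem_coe.1 hT)) h).antisymm
    (key (mem_powerset.1 (mem_coe.1 hT')) h.symm)

theorem eigenvalue_symmetricSet_sub (T : Finset ℕ) (j k : ZMod n) :
    circulantEigenvalue (symmetricSet n T) j - circulantEigenvalue (symmetricSet n T) k =
      ∑ t ∈ T, ∑ s : ZMod n with s.valMinAbs.natAbs = t,
        (ZMod.stdAddChar (j * s) - ZMod.stdAddChar (k * s)) := by
  have hmaps : ∀ s ∈ symmetricSet n T, s.valMinAbs.natAbs ∈ T := fun s hs => (mem_filter.1 hs).2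
  rw [circulantEigenvalue, circulantEigenvalue, ← sum_sub_distrib,
    ← sum_fiberwise_of_maps_to hmaps]
  refine sum_congr rfl fun t ht => sum_congr ?_ fun _ _ => rfl
  ext s
  simp only [symmetricSet, mem_filter, mem_univ, true_and, and_iff_right_iff_imp]
  rintro rfl
  exact ht

theorem filter_natAbs_valMinAbs_eq {t : ℕ} (ht : 2 * t < n) :
    ({s : ZMod n | s.valMinAbs.natAbs = t} : Finset (ZMod n)) = {(t : ZMod n), -(t : ZMod n)} := by
  have h := ZMod.valMinAbs_natCast_of_le_half (n := n) (a := t) (by omega)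
  ext s
  simp only [mem_filter, mem_univ, true_and, mem_insert, mem_singleton]
  constructor
  · intro hs
    have : s.valMinAbs = t ∨ s.valMinAbs = -t := by omega
    rw [← ZMod.coe_valMinAbs s]
    rcases this with h | h
    · left
      simp [h]
    · right
      simp [h]
  · rintro (rfl | rfl)
    · simp [h]
    · simp [ZMod.natAbs_valMinAbs_neg, h]

theorem stdAddChar_add_neg_injective {j k : ZMod n} (hjk : j ≠ k) (hjk' : j ≠ -k) :
    ZMod.stdAddChar j + ZMod.stdAddChar (-j) - ZMod.stdAddChar k - ZMod.stdAddChar (-k) ≠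
      (0 : ℂ) := by
  intro h
  have hj : ZMod.stdAddChar j * ZMod.stdAddChar (-j) = (1 : ℂ) := by
    rw [← AddChar.map_add_eq_mul, add_neg_cancel, AddChar.map_zero_eq_one]
  have hk : ZMod.stdAddChar k * ZMod.stdAddChar (-k) = (1 : ℂ) := by
    rw [← AddChar.map_add_eq_mul, add_neg_cancel, AddChar.map_zero_eq_one]
  have hprod : (ZMod.stdAddChar j - ZMod.stdAddChar k) *
      (ZMod.stdAddChar j - ZMod.stdAddChar (-k)) = (0 : ℂ) := by
    linear_combination ZMod.stdAddChar j * h - hj + hk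
  rcases mul_eq_zero.1 hprod with h | h
  · exact hjk (ZMod.injective_stdAddChar (sub_eq_zero.1 h))
  · exact hjk' (ZMod.injective_stdAddChar (sub_eq_zero.1 h))

theorem card_sq_mul_le_of_small_order {j k : ZMod n} (hjk : j ≠ k) (hjk' : j ≠ -k)
    (B : Finset (Finset ℕ)) (hB : ∀ T ∈ B, T ⊆ Icc 1 (n / 2) ∧
      circulantEigenvalue (symmetricSet n T) j = circulantEigenvalue (symmetricSet n T) k) :
    #B ^ 2 * n ≤ 4 * (addOrderOf j * addOrderOf k) * 4 ^ (n / 2) := by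
  have hn : 0 < n := Nat.pos_of_ne_zero (NeZero.ne n)
  set L := addOrderOf j * addOrderOf k with hL
  have hLpos : 0 < L := Nat.mul_pos (addOrderOf_pos j) (addOrderOf_pos k)
  have hLj : (L : ZMod n) * j = 0 := by
    rw [← nsmul_eq_mul, hL, mul_comm, mul_nsmul', addOrderOf_nsmul_eq_zero, nsmul_zero]
  have hLk : (L : ZMod n) * k = 0 := by
    rw [← nsmul_eq_mul, hL, mul_nsmul', addOrderOf_nsmul_eq_zero, nsmul_zero]
  set K := (n - 1) / (4 * L) with hK
  have hK1 : 4 * L * K + 1 ≤ n := by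
    have : 4 * L * K ≤ n - 1 := Nat.mul_div_le _ _
    omega
  have hK2 : n ≤ 4 * L * (K + 1) := by
    have : n - 1 < 4 * L * (K + 1) := Nat.lt_mul_div_succ _ (by omega)
    omega
  let J : Finset ℕ := (range (2 * K)).image fun i => 1 + L * i
  have hJ2 : ∀ t ∈ J, 1 ≤ t ∧ 2 * t < n := by
    intro t ht
    obtain ⟨i, hi, rfl⟩ := mem_image.1 ht
    have : i + 1 ≤ 2 * K := mem_range.1 hi
    have : L * (i + 1) ≤ L * (2 * K) := Nat.mul_le_mul_left _ this
    refine ⟨by omega, ?_⟩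
    nlinarith
  have hJI : J ⊆ Icc 1 (n / 2) := fun t ht => by
    have := hJ2 t ht
    exact mem_Icc.2 ⟨this.1, by omega⟩
  have hJcard : #J = 2 * K := by
    rw [card_image_of_injective, card_range]
    intro a b h
    exact Nat.eq_of_mul_eq_mul_left hLpos (by simpa using h)
  have hKn : 2 * K ≤ n / 2 := by
    have := card_le_card hJI
    rwa [hJcard, Nat.card_Icc, Nat.add_sub_cancel] at this
  have hcard := card_filter_sum_eq_zero_le hJI (stdAddChar_add_neg_injective hjk hjk')
    (w := fun t => ∑ s : ZMod n with s.valMinAbs.natAbs = t,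
        (ZMod.stdAddChar (j * s) - ZMod.stdAddChar (k * s))) (fun t ht => ?_) B
    fun T hT => ⟨(hB T hT).1, by rw [← eigenvalue_symmetricSet_sub, (hB T hT).2, sub_self]⟩
  · rw [hJcard, Nat.card_Icc, Nat.add_sub_cancel, Nat.mul_div_cancel_left K two_pos,
      ← Nat.centralBinom_eq_two_mul_choose] at hcard
    have hn2 : n ≤ 4 * L * (2 * K + 1) := hK2.trans (Nat.mul_le_mul_left _ (by omega))
    calc #B ^ 2 * n ≤ (K.centralBinom * 2 ^ (n / 2 - 2 * K)) ^ 2 * (4 * L * (2 * K + 1)) := by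
          gcongr
      _ = 4 * L * ((2 * K + 1) * K.centralBinom ^ 2) * 4 ^ (n / 2 - 2 * K) := by
          rw [mul_pow, ← pow_mul, mul_comm (n / 2 - 2 * K), pow_mul]
          ring
      _ ≤ 4 * L * 16 ^ K * 4 ^ (n / 2 - 2 * K) := by
          gcongr
          exact two_mul_add_one_mul_centralBinom_sq_le K
      _ = 4 * L * 4 ^ (n / 2) := by
          have : 16 ^ K = 4 ^ (2 * K) := by rw [pow_mul]; norm_num
          rw [this, mul_assoc, ← pow_add, Nat.add_sub_cancel' hKn]
  · have htn := hJ2 t ht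
    obtain ⟨i, -, rfl⟩ := mem_image.1 ht
    have hne : ((1 + L * i : ℕ) : ZMod n) ≠ -((1 + L * i : ℕ) : ZMod n) := by
      intro h
      rw [eq_neg_iff_add_eq_zero, ← Nat.cast_add, ZMod.natCast_eq_zero_iff] at h
      have := Nat.le_of_dvd (by omega) h
      omega
    have e1 : j * ((1 + L * i : ℕ) : ZMod n) = j := by
      push_cast
      linear_combination (i : ZMod n) * hLj
    have e2 : k * ((1 + L * i : ℕ) : ZMod n) = k := by
      push_cast
      linear_combination (i : ZMod n) * hLk
    change ∑ s : ZMod n with s.valMinAbs.natAbs = 1 + L * i, _ = _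
    rw [filter_natAbs_valMinAbs_eq htn.2, sum_pair hne, mul_neg, mul_neg, e1, e2]
    ring

theorem card_addOrderOf_le (E : ℕ) : #{j : ZMod n | addOrderOf j ≤ E} ≤ E * E := by
  have hsub : ({j : ZMod n | addOrderOf j ≤ E} : Finset (ZMod n)) ⊆
      (Icc 1 E).biUnion fun d => {j : ZMod n | d • j = 0} := by
    intro j hj
    refine mem_biUnion.2 ⟨addOrderOf j, mem_Icc.2 ⟨addOrderOf_pos j, (mem_filter.1 hj).2⟩, ?_⟩
    rw [mem_filter]
    exact ⟨mem_univ _, addOrderOf_nsmul_eq_zero j⟩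
  refine (card_le_card hsub).trans ((card_biUnion_le_card_mul _ _ E fun d hd => ?_).trans_eq ?_)
  · have := mem_Icc.1 hd
    exact (IsAddCyclic.card_nsmul_eq_zero_le (by omega)).trans this.2
  · simp

/-- The sets `T` of absolute values whose circulant graph has an unforced eigenvalue coincidence. -/
noncomputable def badSets (n : ℕ) [NeZero n] : Finset (Finset ℕ) :=
  open Classical in
  {T ∈ (Icc 1 (n / 2)).powerset | ∃ j k : ZMod n, j ≠ k ∧ j ≠ -k ∧
    circulantEigenvalue (symmetricSet n T) j = circulantEigenvalue (symmetricSet n T) k}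

theorem card_badSets_le {R : ℕ} (hR : 1 ≤ R) :
    (#(badSets n) : ℝ) ≤
      2 ^ (n / 2) * (2 * (72 * R ^ 2) ^ 5 / √n + 2 * n ^ 2 / 2 ^ R) := by
  classical
  have hn : 0 < n := Nat.pos_of_ne_zero (NeZero.ne n)
  have hnR : (0 : ℝ) < n := by exact_mod_cast hn
  set E : ℕ := 72 * R ^ 2 with hE
  have hER : (72 * (R : ℝ) ^ 2) = E := by rw [hE]; push_cast; ring
  let B (p : ZMod n × ZMod n) : Finset (Finset ℕ) := {T ∈ (Icc 1 (n / 2)).powerset |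
    circulantEigenvalue (symmetricSet n T) p.1 = circulantEigenvalue (symmetricSet n T) p.2}
  have hBmem (p : ZMod n × ZMod n) (T) (hT : T ∈ B p) : T ⊆ Icc 1 (n / 2) ∧
      circulantEigenvalue (symmetricSet n T) p.1 = circulantEigenvalue (symmetricSet n T) p.2 :=
    ⟨mem_powerset.1 (mem_filter.1 hT).1, (mem_filter.1 hT).2⟩
  let P : Finset (ZMod n × ZMod n) := {p | p.1 ≠ p.2 ∧ p.1 ≠ -p.2}
  let Small (p : ZMod n × ZMod n) : Prop := addOrderOf p.1 ≤ E ∧ addOrderOf p.2 ≤ E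
  have hsub : badSets n ⊆ P.biUnion B := by
    intro T hT
    obtain ⟨hT, j, k, h1, h2, h3⟩ := mem_filter.1 hT
    exact mem_biUnion.2 ⟨(j, k), mem_filter.2 ⟨mem_univ _, h1, h2⟩, mem_filter.2 ⟨hT, h3⟩⟩
  have hsmall : ∀ p ∈ P.filter Small, (#(B p) : ℝ) ≤ 2 ^ (n / 2) * (2 * E / √n) := by
    intro p hp
    obtain ⟨hp, hp1, hp2⟩ := mem_filter.1 hp
    obtain ⟨-, h1, h2⟩ := mem_filter.1 hp
    have h := card_sq_mul_le_of_small_order h1 h2 (B p) (hBmem p)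
    have h' : #(B p) ^ 2 * n ≤ 4 * (E * E) * 4 ^ (n / 2) := h.trans (by gcongr)
    have h'' : (#(B p) : ℝ) ^ 2 * n ≤ 4 * (E * E) * 4 ^ (n / 2) := by exact_mod_cast h'
    rw [← mul_div_assoc, le_div_iff₀ (Real.sqrt_pos.2 hnR)]
    refine (sq_le_sq₀ (by positivity) (by positivity)).1 ?_
    rw [mul_pow, Real.sq_sqrt hnR.le]
    refine h''.trans_eq ?_
    have : (4 : ℝ) ^ (n / 2) = (2 ^ (n / 2)) ^ 2 := by rw [← pow_mul, mul_comm, pow_mul]; norm_num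
    rw [this]
    ring
  have hlarge' {j k : ZMod n} (h1 : j ≠ k) (h2 : j ≠ -k) (hj : E < addOrderOf j)
      (C : Finset (Finset ℕ)) (hC : ∀ T ∈ C, T ⊆ Icc 1 (n / 2) ∧
        circulantEigenvalue (symmetricSet n T) j = circulantEigenvalue (symmetricSet n T) k) :
      (#C : ℝ) ≤ 2 ^ (n / 2) * (2 / 2 ^ R) := by
    have hinj : #(C.image (symmetricSet n)) = #C :=
      card_image_of_injOn (symmetricSet_injOn.mono fun T hT =>
        mem_coe.2 (mem_powerset.2 (hC T hT).1))
    have hE72 : 72 ≤ E := by nlinarith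
    have hφ : R ≤ (addOrderOf j).totient / 6 := by
      rw [Nat.le_div_iff_mul_le (by norm_num)]
      by_contra! hlt
      have := le_two_mul_totient_sq (addOrderOf j)
      have : (addOrderOf j).totient ^ 2 ≤ (R * 6) ^ 2 := by gcongr
      nlinarith
    have h := card_le_two_pow_of_large_order h1 h2 (by omega) (C.image (symmetricSet n)) ?_
    · rw [hinj] at h
      have h' : #C * 2 ^ R ≤ 2 ^ (n / 2 + 1) :=
        (Nat.mul_le_mul_left _ (Nat.pow_le_pow_right two_pos hφ)).trans h
      have h'' : (#C : ℝ) * 2 ^ R ≤ 2 ^ (n / 2 + 1) := by exact_mod_cast h'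
      rw [← mul_div_assoc, le_div_iff₀ (by positivity), ← pow_succ]
      exact h''
    · intro S hS
      obtain ⟨T, hT, rfl⟩ := mem_image.1 hS
      exact ⟨mem_symmetricSet_iff_neg T, (hC T hT).2⟩
  have hlarge : ∀ p ∈ P.filter (¬ Small ·), (#(B p) : ℝ) ≤ 2 ^ (n / 2) * (2 / 2 ^ R) := by
    intro p hp
    obtain ⟨hp, hps⟩ := mem_filter.1 hp
    obtain ⟨-, h1, h2⟩ := mem_filter.1 hp
    rcases not_and_or.1 hps with h | h
    · exact hlarge' h1 h2 (not_le.1 h) (B p) (hBmem p)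
    · exact hlarge' h1.symm (fun h => h2 (by rw [h, neg_neg])) (not_le.1 h) (B p)
        fun T hT => ⟨(hBmem p T hT).1, (hBmem p T hT).2.symm⟩
  have hcs : (#(P.filter Small) : ℝ) ≤ E ^ 4 := by
    have : P.filter Small ⊆ ({j : ZMod n | addOrderOf j ≤ E} : Finset (ZMod n)) ×ˢ
        ({j : ZMod n | addOrderOf j ≤ E} : Finset (ZMod n)) := by
      intro p hp
      have := (mem_filter.1 hp).2
      simpa [Small] using this
    have h := (card_le_card this).trans_eq (card_product _ _)
    have h' : #(P.filter Small) ≤ (E * E) * (E * E) :=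
      h.trans (Nat.mul_le_mul (card_addOrderOf_le E) (card_addOrderOf_le E))
    calc (#(P.filter Small) : ℝ) ≤ ((E * E) * (E * E) : ℕ) := by exact_mod_cast h'
      _ = E ^ 4 := by push_cast; ring
  have hcl : (#(P.filter (¬ Small ·)) : ℝ) ≤ n ^ 2 := by
    have h := card_le_univ (P.filter (¬ Small ·))
    rw [Fintype.card_prod, ZMod.card] at h
    calc (#(P.filter (¬ Small ·)) : ℝ) ≤ (n * n : ℕ) := by exact_mod_cast h
      _ = n ^ 2 := by push_cast; ring
  calc (#(badSets n) : ℝ) ≤ ∑ p ∈ P, (#(B p) : ℝ) := by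
        exact_mod_cast (card_le_card hsub).trans card_biUnion_le
    _ = ∑ p ∈ P.filter Small, (#(B p) : ℝ) + ∑ p ∈ P.filter (¬ Small ·), (#(B p) : ℝ) :=
        (sum_filter_add_sum_filter_not _ _ _).symm
    _ ≤ #(P.filter Small) * (2 ^ (n / 2) * (2 * E / √n)) +
        #(P.filter (¬ Small ·)) * (2 ^ (n / 2) * (2 / 2 ^ R)) := by
        simp only [← nsmul_eq_mul]
        exact add_le_add (sum_le_card_nsmul _ _ _ hsmall) (sum_le_card_nsmul _ _ _ hlarge)
    _ ≤ E ^ 4 * (2 ^ (n / 2) * (2 * E / √n)) + n ^ 2 * (2 ^ (n / 2) * (2 / 2 ^ R)) := by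
        gcongr
    _ = _ := by
        rw [hER]
        ring

theorem two_pow_sub_card_badSets_le :
    (2 : ℝ) ^ (n / 2) - #(badSets n) ≤
      ({S : Finset (ZMod n) | (0 : ZMod n) ∉ S ∧ (∀ x : ZMod n, x ∈ S ↔ -x ∈ S) ∧
        IsTinhoferCompact n S}.ncard : ℝ) := by
  classical
  have hsub : badSets n ⊆ (Icc 1 (n / 2)).powerset := filter_subset _ _
  have hcard : #((Icc 1 (n / 2)).powerset \ badSets n) + #(badSets n) = 2 ^ (n / 2) := by
    rw [card_sdiff_add_card_eq_card hsub, card_powerset, Nat.card_Icc, Nat.add_sub_cancel]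
  have himg : #(((Icc 1 (n / 2)).powerset \ badSets n).image (symmetricSet n)) =
      #((Icc 1 (n / 2)).powerset \ badSets n) :=
    card_image_of_injOn (symmetricSet_injOn.mono (coe_subset.2 sdiff_subset))
  have hle := Set.ncard_le_ncard (s := (((Icc 1 (n / 2)).powerset \ badSets n).image
      (symmetricSet n) : Set (Finset (ZMod n))))
    (t := {S : Finset (ZMod n) | (0 : ZMod n) ∉ S ∧ (∀ x : ZMod n, x ∈ S ↔ -x ∈ S) ∧
        IsTinhoferCompact n S}) ?_ (Set.toFinite _)
  · rw [Set.ncard_coe_finset, himg] at hle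
    have hcard' : (#((Icc 1 (n / 2)).powerset \ badSets n) : ℝ) + #(badSets n) = 2 ^ (n / 2) := by
      exact_mod_cast hcard
    rw [← hcard', add_sub_cancel_right]
    exact_mod_cast hle
  · intro S hS
    obtain ⟨T, hT, rfl⟩ := mem_image.1 (mem_coe.1 hS)
    obtain ⟨hT, hbad⟩ := mem_sdiff.1 hT
    refine ⟨zero_notMem_symmetricSet (mem_powerset.1 hT), mem_symmetricSet_iff_neg T,
      isTinhoferCompact_of_separated (mem_symmetricSet_iff_neg T) fun j k h => ?_⟩
    by_contra! hne
    exact hbad (mem_filter.2 ⟨hT, j, k, hne.1, hne.2, h⟩)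

end Counting

open Filter in
theorem eventually_failure_bound_le {ε : ℝ} (hε : 0 < ε) : ∀ᶠ n : ℕ in atTop,
    1 ≤ ⌊(n : ℝ) ^ (ε / 20)⌋₊ ∧
    2 * (72 * (⌊(n : ℝ) ^ (ε / 20)⌋₊ : ℝ) ^ 2) ^ 5 / √n + 2 * n ^ 2 / 2 ^ ⌊(n : ℝ) ^ (ε / 20)⌋₊ ≤
      (n : ℝ) ^ (-(1 / 2 : ℝ) + ε) := by
  have hδ : 0 < ε / 20 := by positivity
  have hcast := tendsto_natCast_atTop_atTop (R := ℝ)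
  have hlog := hcast.eventually ((isLittleO_log_rpow_atTop hδ).bound (show (0 : ℝ) < 1 / 12 by
    norm_num))
  have hδn := ((tendsto_rpow_atTop hδ).comp hcast).eventually_ge_atTop (2 * (1 + 2 * Real.log 4))
  have hεn := ((tendsto_rpow_atTop (half_pos hε)).comp hcast).eventually_ge_atTop (4 * 72 ^ 5)
  filter_upwards [hlog, hδn, hεn, eventually_ge_atTop 1] with n h1 h2 h3 hn
  simp only [Function.comp_apply] at h2 h3
  have hn1 : (1 : ℝ) ≤ n := by exact_mod_cast hn
  have hn0 : (0 : ℝ) < n := by linarith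
  have hlog0 : 0 ≤ Real.log n := Real.log_nonneg hn1
  have hlog4 : 0 < Real.log 4 := Real.log_pos (by norm_num)
  set x : ℝ := (n : ℝ) ^ (ε / 20) with hx
  have hx0 : 0 < x := by positivity
  rw [Real.norm_of_nonneg hlog0, Real.norm_of_nonneg hx0.le] at h1
  set R := ⌊x⌋₊ with hR
  have hR1 : (R : ℝ) ≤ x := Nat.floor_le hx0.le
  have hR2 : x < R + 1 := Nat.lt_floor_add_one x
  have hone : (n : ℝ) ^ (-(1 / 2 : ℝ) + ε) = n ^ ε / √n := by
    rw [Real.rpow_add hn0, Real.rpow_neg hn0.le, ← Real.sqrt_eq_rpow]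
    ring
  have hx10 : x ^ 10 = (n : ℝ) ^ (ε / 2) := by
    rw [hx, ← Real.rpow_natCast, ← Real.rpow_mul hn0.le]
    congr 1
    push_cast
    ring
  have hεε : (n : ℝ) ^ ε = n ^ (ε / 2) * n ^ (ε / 2) := by
    rw [← Real.rpow_add hn0, add_halves]
  have hsq : 0 < √(n : ℝ) := Real.sqrt_pos.2 hn0
  refine ⟨Nat.le_floor (by push_cast; linarith), ?_⟩
  have hA : 2 * (72 * (R : ℝ) ^ 2) ^ 5 / √n ≤ n ^ ε / 2 / √n := by
    gcongr
    calc 2 * (72 * (R : ℝ) ^ 2) ^ 5 ≤ 2 * (72 * x ^ 2) ^ 5 := by gcongr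
      _ = 2 * 72 ^ 5 * x ^ 10 := by ring
      _ ≤ n ^ ε / 2 := by
        rw [hx10, hεε]
        nlinarith
  have hpow : 4 * (n : ℝ) ^ 3 ≤ 2 ^ R := by
    have hlog2 : (1 : ℝ) / 2 ≤ Real.log 2 := by linarith [Real.log_two_gt_d9]
    rw [← Real.log_le_log_iff (by positivity) (by positivity),
      Real.log_mul (by norm_num) (by positivity), Real.log_pow, Real.log_pow]
    push_cast
    have : (R : ℝ) * (1 / 2) ≤ R * Real.log 2 := by gcongr
    linarith
  have hB : 2 * (n : ℝ) ^ 2 / 2 ^ R ≤ n ^ ε / 2 / √n := by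
    have hsn : √(n : ℝ) ≤ n := by
      rw [Real.sqrt_le_left hn0.le]
      nlinarith
    have hε1 : 1 ≤ (n : ℝ) ^ ε := Real.one_le_rpow hn1 hε.le
    rw [div_le_div_iff₀ (by positivity) hsq]
    calc 2 * (n : ℝ) ^ 2 * √n ≤ 2 * (n : ℝ) ^ 2 * (n : ℝ) := by gcongr
      _ = 1 / 2 * (4 * (n : ℝ) ^ 3) := by ring
      _ ≤ (n : ℝ) ^ ε / 2 * 2 ^ R := by gcongr
  calc _ ≤ n ^ ε / 2 / √n + n ^ ε / 2 / √(n : ℝ) := add_le_add hA hB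
    _ = _ := by rw [hone]; ring

/-- Almost all circulant graphs are compact: for every `ε > 0` and all sufficiently
large `n`, at least `(1 - n^{-1/2+ε})·2^{⌊n/2⌋}` of the `2^{⌊n/2⌋}` inverse-closed
connection sets `S ⊆ Z_n \ {0}` give a compact graph `Cay(Z_n, S)`. -/
theorem stmt16 :
    ∀ ε : ℝ, 0 < ε → ∃ N : ℕ, ∀ n : ℕ, N ≤ n →
      (1 - (n : ℝ) ^ (-(1 / 2 : ℝ) + ε)) * 2 ^ (n / 2) ≤
        ({S : Finset (ZMod n) | (0 : ZMod n) ∉ S ∧ (∀ x : ZMod n, x ∈ S ↔ -x ∈ S) ∧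
          IsTinhoferCompact n S}.ncard : ℝ) := by
  intro ε hε
  obtain ⟨N, hN⟩ := Filter.eventually_atTop.1 (eventually_failure_bound_le hε)
  refine ⟨max N 1, fun n hn => ?_⟩
  have : NeZero n := ⟨by have := le_of_max_le_right hn; omega⟩
  obtain ⟨hR, hbound⟩ := hN n (le_of_max_le_left hn)
  refine le_trans ?_ two_pow_sub_card_badSets_le
  have hbad := (card_badSets_le (n := n) hR).trans (mul_le_mul_of_nonneg_left hbound (by positivity))
  linarith
end

section
/- Let n ≥ 3 and let X be a digraph on a finite vertex set V with |V| = n. Suppose X is a firm circulant digraph: X is isomorphic to Cay(Z_n,S) for some S ⊆ Z_n \ {0}, and the automorphism group of X has exactly n elements. Then the number of Cayley representations of X, i.e., bijections λ : V → Z_n for which there exists T ⊆ Z_n \ {0} such that for all u, v ∈ V, (u,v) is an arc of X if and only if λ(v) − λ(u) ∈ T, equals n·φ(n), where φ is Euler's totient function. (Equivalently, X has exactly φ(n) Cayley representations up to equivalence, where λ and λ' are equivalent if they yield the same relabeled digraph X^λ = X^{λ'}.) -/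
/-- A self-map of `ZMod n` that turns the successor into adding `a` is affine. -/
theorem ZMod.eq_add_mul_of_map_add_one {n : ℕ} [NeZero n] {g : ZMod n → ZMod n} {a : ZMod n}
    (h : ∀ x, g (x + 1) = g x + a) (x : ZMod n) : g x = g 0 + x * a := by
  have key : ∀ k : ℕ, g (k : ZMod n) = g 0 + k * a := by
    intro k
    induction k with
    | zero => simp
    | succ k ih => push_cast; rw [h, ih]; ring
  simpa using key x.val

/-- In a firm circulant digraph every automorphism is a translation. -/
theorem exists_translation_of_firm {n : ℕ} [NeZero n] {V : Type*} [Fintype V]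
    {E : V → V → Prop} {S : Finset (ZMod n)} (φ : V ≃ ZMod n)
    (hφ : ∀ u v : V, E u v ↔ φ v - φ u ∈ S)
    (hfirm : Nat.card {σ : V ≃ V // ∀ u v : V, E (σ u) (σ v) ↔ E u v} = n)
    (σ : V ≃ V) (hσ : ∀ u v : V, E (σ u) (σ v) ↔ E u v) :
    ∃ a : ZMod n, ∀ v, φ (σ v) = φ v + a := by
  let τ : ZMod n → {σ : V ≃ V // ∀ u v : V, E (σ u) (σ v) ↔ E u v} := fun a =>
    ⟨(φ.trans (Equiv.addRight a)).trans φ.symm, fun u v => by simp [hφ]⟩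
  have hτ : ∀ a v, φ ((τ a).1 v) = φ v + a := fun a v => by simp [τ]
  have hinj : Function.Injective τ := fun a b hab => by
    have := hτ a (φ.symm 0)
    rw [hab, hτ] at this
    simpa using this.symm
  have hbij : Function.Bijective τ :=
    hinj.bijective_of_nat_card_le (by rw [hfirm, Nat.card_zmod])
  obtain ⟨a, ha⟩ := hbij.2 ⟨σ, hσ⟩
  exact ⟨a, fun v => by rw [← hτ, ha]⟩

/-- Any two Cayley representations of a firm circulant digraph differ by an affine map. -/
theorem exists_affine_of_firm {n : ℕ} [NeZero n] {V : Type*} [Fintype V]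
    {E : V → V → Prop} {S T : Finset (ZMod n)} (φ l : V ≃ ZMod n)
    (hφ : ∀ u v : V, E u v ↔ φ v - φ u ∈ S)
    (hfirm : Nat.card {σ : V ≃ V // ∀ u v : V, E (σ u) (σ v) ↔ E u v} = n)
    (hl : ∀ u v : V, E u v ↔ l v - l u ∈ T) :
    ∃ (c : ZMod n) (w : (ZMod n)ˣ), ∀ v, l v = w * φ v + c := by
  obtain ⟨a, ha⟩ := exists_translation_of_firm φ hφ hfirm
    ((l.trans (Equiv.addRight 1)).trans l.symm) (fun u v => by simp [hl])
  have hg := ZMod.eq_add_mul_of_map_add_one (g := fun x => φ (l.symm x)) (a := a)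
    (fun x => by simpa using ha (l.symm x))
  obtain ⟨b, hb⟩ : ∃ b, b * a = 1 := by
    refine ⟨l (φ.symm (φ (l.symm 0) + 1)), ?_⟩
    have := hg (l (φ.symm (φ (l.symm 0) + 1)))
    simpa using this.symm
  refine ⟨-(b * φ (l.symm 0)), ⟨b, a, hb, by rw [mul_comm, hb]⟩, fun v => ?_⟩
  have := hg (l v)
  rw [Equiv.symm_apply_apply] at this
  rw [this]
  linear_combination (-l v) * hb


/-- A firm circulant digraph `X` on `n ≥ 3` vertices (i.e. `X` is isomorphic to some
Cayley digraph of `Z_n` and `|Aut(X)| = n`) has exactly `n·φ(n)` Cayley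
representations, i.e. bijections `λ : V → Z_n` turning `X` into a Cayley digraph of
`Z_n` (equivalently, `φ(n)` of them up to equivalence, each equivalence class having
`n` members). -/
theorem stmt19 (n : ℕ) (hn : 3 ≤ n) (V : Type*) [Fintype V] [DecidableEq V]
    (hV : Fintype.card V = n) (E : V → V → Prop)
    (hcirc : ∃ S : Finset (ZMod n), (0 : ZMod n) ∉ S ∧
      ∃ φ : V ≃ ZMod n, ∀ u v : V, E u v ↔ φ v - φ u ∈ S)
    (hfirm : Nat.card {φ : V ≃ V // ∀ u v : V, E (φ u) (φ v) ↔ E u v} = n) :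
    {l : V → ZMod n | Function.Bijective l ∧
      ∃ T : Finset (ZMod n), (0 : ZMod n) ∉ T ∧
        ∀ u v : V, E u v ↔ l v - l u ∈ T}.ncard = n * Nat.totient n := by
  have : NeZero n := ⟨by omega⟩
  obtain ⟨S, hS, φ, hφ⟩ := hcirc
  let f : ZMod n × (ZMod n)ˣ → V → ZMod n := fun p v => p.2 * φ v + p.1
  have hf : Function.Injective f := by
    rintro ⟨c, w⟩ ⟨d, z⟩ h
    have h0 : c = d := by simpa [f] using congrFun h (φ.symm 0)
    have h1 : (w : ZMod n) = z := by simpa [f, h0] using congrFun h (φ.symm 1)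
    rw [h0, Units.ext h1]
  have hset : {l : V → ZMod n | Function.Bijective l ∧
      ∃ T : Finset (ZMod n), (0 : ZMod n) ∉ T ∧
        ∀ u v : V, E u v ↔ l v - l u ∈ T} = f '' Set.univ := by
    ext l
    simp only [Set.mem_ofPred_eq, Set.image_univ, Set.mem_range]
    constructor
    · rintro ⟨hl, T, -, hT⟩
      obtain ⟨c, w, h⟩ := exists_affine_of_firm φ (Equiv.ofBijective l hl) hφ hfirm hT
      exact ⟨(c, w), funext fun v => (h v).symm⟩
    · rintro ⟨⟨c, w⟩, rfl⟩
      refine ⟨((φ.trans w.mulLeft).trans (Equiv.addRight c)).bijective,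
        S.image (fun s => (w : ZMod n) * s), by simpa using hS, fun u v => ?_⟩
      have h : f (c, w) v - f (c, w) u = w * (φ v - φ u) := by simp only [f]; ring
      rw [h, hφ, w.isUnit.mul_right_injective.mem_finset_image]
  rw [hset, Set.ncard_image_of_injective _ hf, Set.ncard_univ, Nat.card_prod, Nat.card_zmod,
    Nat.card_eq_fintype_card, ZMod.card_units_eq_totient]
end
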